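/- arXiv:2501.11461 — 4 statements merged into one kernel-verified Lean document; each statement's English description precedes it below -/
import Mathlib

section
/- Let n be a positive integer and let C be a finite set of binary words of length n. Let S(C) = {d_H(x,y) : x, y ∈ C, x ≠ y} be its set of Hamming distances and let s = |S(C)|. If for every a ∈ S(C) also n − a ∈ S(C), then |C| ≤ Σ_{0 ≤ i ≤ s, i ≡ s (mod 2)} binom(n, i). -/
open Finset

/-- The sign `-1` or `1` attached to a bit. -/
def bitSign (b : Bool) : ℝ := if b then -1 else 1

/-- The Walsh character of the binary cube indexed by `A`. -/
def walsh {n : ℕ} (A : Finset (Fin n)) (y : Fin n → Bool) : ℝ := ∏ i ∈ A, bitSign (y i)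

/-- The inner product of the sign vectors of two binary words. -/
def signInner {n : ℕ} (x y : Fin n → Bool) : ℝ := ∑ i, bitSign (x i) * bitSign (y i)

/-- The subsets of `Fin n` of size at most `k` and of the same parity as `k`. -/
def paritySets (n k : ℕ) : Finset (Finset (Fin n)) :=
  ((range (k + 1)).filter fun i => i % 2 = k % 2).biUnion fun i => powersetCard i univ

lemma mem_paritySets {n k : ℕ} {A : Finset (Fin n)} :
    A ∈ paritySets n k ↔ #A ≤ k ∧ #A % 2 = k % 2 := by
  simp [paritySets, mem_powersetCard]

lemma card_paritySets_le (n k : ℕ) :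
    #(paritySets n k) ≤ ∑ i ∈ (range (k + 1)).filter (fun i => i % 2 = k % 2), n.choose i := by
  refine card_biUnion_le.trans (le_of_eq (sum_congr rfl fun i _ => ?_))
  simp [card_powersetCard]

/-- The span of the Walsh characters of degree at most `k` and of the same parity as `k`. -/
def walshSpan (n k : ℕ) : Submodule ℝ ((Fin n → Bool) → ℝ) :=
  Submodule.span ℝ (walsh '' (paritySets n k : Set (Finset (Fin n))))

lemma walsh_mem_walshSpan {n k : ℕ} {A : Finset (Fin n)} (h : #A ≤ k) (h2 : #A % 2 = k % 2) :
    walsh A ∈ walshSpan n k :=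
  Submodule.subset_span ⟨A, by simpa using mem_paritySets.2 ⟨h, h2⟩, rfl⟩

lemma walshSpan_mono {n i k : ℕ} (h : i ≤ k) (h2 : i % 2 = k % 2) :
    walshSpan n i ≤ walshSpan n k := by
  refine Submodule.span_mono (Set.image_mono fun A hA => ?_)
  have hA := mem_paritySets.1 (mem_coe.1 hA)
  exact mem_coe.2 (mem_paritySets.2 ⟨by omega, by omega⟩)

lemma bitSign_mul_self (b : Bool) : bitSign b * bitSign b = 1 := by
  cases b <;> simp [bitSign]

lemma bitSign_mul_walsh_mem {n k : ℕ} {A : Finset (Fin n)} (hA : A ∈ paritySets n k)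
    (i : Fin n) : (fun y => bitSign (y i) * walsh A y) ∈ walshSpan n (k + 1) := by
  obtain ⟨h, h2⟩ := mem_paritySets.1 hA
  by_cases hi : i ∈ A
  · have hc := card_erase_add_one hi
    have he : (fun y => bitSign (y i) * walsh A y) = walsh (A.erase i) := by
      funext y
      simp only [walsh]
      rw [← mul_prod_erase A _ hi, ← mul_assoc, bitSign_mul_self, one_mul]
    rw [he]
    exact walsh_mem_walshSpan (by omega) (by omega)
  · have hc := card_insert_of_notMem hi
    have he : (fun y => bitSign (y i) * walsh A y) = walsh (insert i A) := by
      funext y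
      simp only [walsh]
      rw [prod_insert hi]
    rw [he]
    exact walsh_mem_walshSpan (by omega) (by omega)

lemma signInner_mul_mem {n k : ℕ} (x : Fin n → Bool) {g : (Fin n → Bool) → ℝ}
    (hg : g ∈ walshSpan n k) : signInner x * g ∈ walshSpan n (k + 1) := by
  induction hg using Submodule.span_induction with
  | mem g hg =>
    obtain ⟨A, hA, rfl⟩ := hg
    have he : signInner x * walsh A
        = ∑ i, bitSign (x i) • fun y => bitSign (y i) * walsh A y := by
      funext y
      simp [signInner, sum_mul, mul_assoc]
    rw [he]
    exact Submodule.sum_mem _ fun i _ =>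
      Submodule.smul_mem _ _ (bitSign_mul_walsh_mem (mem_coe.1 hA) i)
  | zero => simp
  | add f g _ _ hf hg => rw [mul_add]; exact Submodule.add_mem _ hf hg
  | smul c g _ hg => rw [mul_smul_comm]; exact Submodule.smul_mem _ _ hg

lemma signInner_pow_mem {n : ℕ} (x : Fin n → Bool) (k : ℕ) :
    signInner x ^ k ∈ walshSpan n k := by
  induction k with
  | zero =>
    have he : signInner x ^ 0 = walsh ∅ := by funext y; simp [walsh]
    rw [he]
    exact walsh_mem_walshSpan (by simp) (by simp)
  | succ k ih => rw [pow_succ']; exact signInner_mul_mem x ih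

lemma signInner_eq {n : ℕ} (x y : Fin n → Bool) :
    signInner x y = n - 2 * hammingDist x y := by
  have h : ∀ i, bitSign (x i) * bitSign (y i) = 1 - 2 * if x i ≠ y i then 1 else 0 := by
    intro i
    cases x i <;> cases y i <;> norm_num [bitSign]
  simp only [signInner, h, sum_sub_distrib, ← mul_sum, sum_boole, hammingDist]
  simp

/-- A polynomial whose roots form a symmetric set has only coefficients of the parity of its
degree. -/
lemma coeff_prod_X_sub_C_eq_zero {T : Finset ℝ} (hT : ∀ t ∈ T, -t ∈ T) {i : ℕ}
    (hi : i % 2 ≠ #T % 2) :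
    (∏ t ∈ T, (Polynomial.X - Polynomial.C t)).coeff i = 0 := by
  set f := ∏ t ∈ T, (Polynomial.X - Polynomial.C t) with hf
  have hcomp : f.comp (-Polynomial.X) = Polynomial.C ((-1) ^ #T) * f := by
    have hneg : f = ∏ t ∈ T, (Polynomial.X + Polynomial.C t) :=
      prod_bij' (fun t _ => -t) (fun t _ => -t) hT hT (by simp) (by simp)
        (by simp [sub_eq_add_neg])
    conv_rhs => rw [hneg]
    rw [hf, Polynomial.prod_comp, map_pow, ← prod_const, ← prod_mul_distrib]
    refine prod_congr rfl fun t _ => ?_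
    simp only [Polynomial.sub_comp, Polynomial.X_comp, Polynomial.C_comp, map_neg, map_one]
    ring
  have hc := congrArg (fun p => Polynomial.coeff p i) hcomp
  have hX : (-Polynomial.X : Polynomial ℝ) = Polynomial.C (-1) * Polynomial.X := by simp
  simp only [hX, Polynomial.comp_C_mul_X_coeff, Polynomial.coeff_C_mul] at hc
  rcases Nat.even_or_odd i with h1 | h1 <;> rcases Nat.even_or_odd #T with h2 | h2
  · rw [Nat.even_iff] at h1 h2; omega
  · rw [h1.neg_one_pow, h2.neg_one_pow] at hc; linarith
  · rw [h1.neg_one_pow, h2.neg_one_pow] at hc; linarith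
  · rw [Nat.odd_iff] at h1 h2; omega

lemma eval_signInner_mem {n : ℕ} {T : Finset ℝ} (hT : ∀ t ∈ T, -t ∈ T) (x : Fin n → Bool) :
    (fun y => ∏ t ∈ T, (signInner x y - t)) ∈ walshSpan n #T := by
  set f := ∏ t ∈ T, (Polynomial.X - Polynomial.C t) with hf
  have hdeg : f.natDegree = #T := by simp [hf]
  have he : (fun y => ∏ t ∈ T, (signInner x y - t))
      = ∑ i ∈ range (#T + 1), f.coeff i • signInner x ^ i := by
    funext y
    have := Polynomial.eval_eq_sum_range (p := f) (signInner x y)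
    rw [hdeg] at this
    simp only [Finset.sum_apply, Pi.smul_apply, Pi.pow_apply, smul_eq_mul]
    rw [← this, hf, Polynomial.eval_prod]
    simp
  rw [he]
  refine Submodule.sum_mem _ fun i hi => ?_
  by_cases h : i % 2 = #T % 2
  · exact Submodule.smul_mem _ _
      (walshSpan_mono (Nat.lt_succ_iff.1 (mem_range.1 hi)) h (signInner_pow_mem x i))
  · rw [coeff_prod_X_sub_C_eq_zero hT h, zero_smul]
    exact Submodule.zero_mem _

lemma card_le_card_paritySets {n k : ℕ} {ι : Type*} {C : Finset ι}
    {v : C → (Fin n → Bool) → ℝ} (hv : LinearIndependent ℝ v) (hmem : ∀ x, v x ∈ walshSpan n k) :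
    #C ≤ #(paritySets n k) := by
  classical
  have hli : LinearIndependent ℝ fun x => (⟨v x, hmem x⟩ : walshSpan n k) :=
    LinearIndependent.of_comp (walshSpan n k).subtype hv
  have hspan : walshSpan n k
      = Submodule.span ℝ (((paritySets n k).image walsh : Finset _) : Set _) := by
    rw [coe_image, walshSpan]
  calc #C = Fintype.card C := (Fintype.card_coe C).symm
    _ ≤ Module.finrank ℝ (walshSpan n k) := hli.fintype_card_le_finrank
    _ ≤ #((paritySets n k).image walsh) := by rw [hspan]; exact finrank_span_finset_le_card _
    _ ≤ #(paritySets n k) := card_image_le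

/-- Functions with a nonsingular diagonal matrix of values are linearly independent. -/
lemma linearIndependent_of_eval_diagonal {α : Type*} {C : Finset α} {F : α → α → ℝ}
    (hdiag : ∀ x ∈ C, F x x ≠ 0) (hoff : ∀ x ∈ C, ∀ y ∈ C, x ≠ y → F x y = 0) :
    LinearIndependent ℝ fun x : C => F x := by
  rw [Fintype.linearIndependent_iff]
  intro g hg x
  have h := congrFun hg x
  simp only [Finset.sum_apply, Pi.smul_apply, smul_eq_mul, Pi.zero_apply] at h
  rw [Fintype.sum_eq_single x fun z hz => by
    rw [hoff z z.2 x x.2 fun h => hz (Subtype.ext h), mul_zero]] at h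
  exact (mul_eq_zero.1 h).resolve_right (hdiag x x.2)

/-- A binary code whose sign vectors have pairwise inner products in a symmetric set `T` not
containing `n` has at most as many words as there are subsets of size at most `#T` and of the parity
of `#T`. -/
lemma card_le_card_paritySets_of_neg_mem {n : ℕ} {C : Finset (Fin n → Bool)} {T : Finset ℝ}
    (hT : ∀ t ∈ T, -t ∈ T) (hne : (n : ℝ) ∉ T)
    (hoff : ∀ x ∈ C, ∀ y ∈ C, x ≠ y → signInner x y ∈ T) :
    #C ≤ #(paritySets n #T) := by
  have hli := linearIndependent_of_eval_diagonal (C := C)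
    (F := fun x y => ∏ t ∈ T, (signInner x y - t))
    (fun x _ => prod_ne_zero_iff.2 fun t ht h => hne (by
      rw [signInner_eq, hammingDist_self, Nat.cast_zero, mul_zero, sub_zero] at h
      rwa [sub_eq_zero.1 h]))
    (fun x hx y hy hxy => prod_eq_zero (hoff x hx y hy hxy) (sub_self _))
  have hmem : ∀ x : C, (fun y => ∏ t ∈ T, (signInner (x : Fin n → Bool) y - t)) ∈ walshSpan n #T :=
    fun x => eval_signInner_mem hT x.1
  exact card_le_card_paritySets (C := C)
    (v := fun x : C => fun y => ∏ t ∈ T, (signInner (x : Fin n → Bool) y - t)) hli hmem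

/-- If the set of Hamming distances of a binary code `C` of length `n`
is symmetric with respect to `n / 2`, then `|C| ≤ ∑_{0 ≤ i ≤ s, i ≡ s (mod 2)} C(n, i)`,
where `s` is the number of distinct distances. -/
theorem stmt_0 (n : ℕ) (hn : 0 < n) (C : Finset (Fin n → Bool))
    (S : Finset ℕ)
    (hS : S = ((C ×ˢ C).filter fun p => p.1 ≠ p.2).image fun p => hammingDist p.1 p.2)
    (hsym : ∀ a ∈ S, n - a ∈ S) :
    C.card ≤ ∑ i ∈ (Finset.range (S.card + 1)).filter (fun i => i % 2 = S.card % 2),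
      n.choose i := by
  have hmem : ∀ x ∈ C, ∀ y ∈ C, x ≠ y → hammingDist x y ∈ S := fun x hx y hy hxy =>
    hS ▸ mem_image.2 ⟨(x, y), mem_filter.2 ⟨mem_product.2 ⟨hx, hy⟩, hxy⟩, rfl⟩
  have hbound : ∀ a ∈ S, 0 < a ∧ a ≤ n := by
    intro a ha
    rw [hS] at ha
    obtain ⟨p, hp, rfl⟩ := mem_image.1 ha
    exact ⟨hammingDist_pos.2 (mem_filter.1 hp).2,
      by simpa using hammingDist_le_card_fintype (x := p.1) (y := p.2)⟩
  set T : Finset ℝ := S.image fun a : ℕ => (n : ℝ) - 2 * a with hTdef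
  have hcard : #T = #S := card_image_of_injective _ fun a b h => by
    have h : (n : ℝ) - 2 * a = n - 2 * b := h
    exact_mod_cast (by linarith : (a : ℝ) = b)
  have hT : ∀ t ∈ T, -t ∈ T := by
    intro t ht
    obtain ⟨a, ha, rfl⟩ := mem_image.1 ht
    refine mem_image.2 ⟨n - a, hsym a ha, ?_⟩
    rw [Nat.cast_sub (hbound a ha).2]
    ring
  have hne : (n : ℝ) ∉ T := by
    intro h
    obtain ⟨a, ha, h⟩ := mem_image.1 h
    have : (0 : ℝ) < a := by exact_mod_cast (hbound a ha).1
    linarith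
  have hoff : ∀ x ∈ C, ∀ y ∈ C, x ≠ y → signInner x y ∈ T := fun x hx y hy hxy =>
    mem_image.2 ⟨_, hmem x hx y hy hxy, (signInner_eq x y).symm⟩
  have hle := (card_le_card_paritySets_of_neg_mem hT hne hoff).trans (card_paritySets_le n #T)
  rwa [hcard] at hle
end

section
/- Let n be a positive integer and let C be a Johnson code with symmetric distances and degree s. Then |C| ≤ binom(2n−1, s). -/
open Finset

/-- The set of Johnson distances between distinct codewords of `C`. -/
def johnsonDistSet (n : ℕ) (C : Finset (Finset (Fin (2 * n)))) : Finset ℕ :=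
  ((C ×ˢ C).filter fun p => p.1 ≠ p.2).image fun p => n - (p.1 ∩ p.2).card

/-- The space of functions on a family `C` spanned by the indicators of containing `T`,
where `T` ranges over the `i`-subsets of `V`. -/
def inclusionSpan {α : Type*} [DecidableEq α] (V : Finset α) (C : Finset (Finset α)) (i : ℕ) :
    Submodule ℚ (C → ℚ) :=
  Submodule.span ℚ
    (((powersetCard i V).image fun T => fun y : C => if T ⊆ y.1 then (1 : ℚ) else 0 :
      Finset (C → ℚ)) : Set (C → ℚ))

section

variable {α : Type*} [DecidableEq α] {V : Finset α} {C : Finset (Finset α)} {k i : ℕ}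

theorem indicator_mem_inclusionSpan {T : Finset α} (hT : T ⊆ V) (hi : T.card = i) :
    (fun y : C => if T ⊆ y.1 then (1 : ℚ) else 0) ∈ inclusionSpan V C i :=
  Submodule.subset_span <| by
    simpa only [coe_image] using Set.mem_image_of_mem _ (by simp [mem_powersetCard, hT, hi])

theorem inclusionSpan_le_succ (hV : ∀ x ∈ C, x ⊆ V) (hk : ∀ x ∈ C, x.card = k) (hi : i < k) :
    inclusionSpan V C i ≤ inclusionSpan V C (i + 1) := by
  refine Submodule.span_le.2 fun g hg => ?_
  simp only [coe_image, Set.mem_image, mem_coe, mem_powersetCard] at hg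
  obtain ⟨T, ⟨hTV, hT⟩, rfl⟩ := hg
  have hpos : ((k : ℚ) - i) ≠ 0 := sub_ne_zero.2 (by exact_mod_cast hi.ne')
  have key : (fun y : C => if T ⊆ y.1 then (1 : ℚ) else 0) = ((k : ℚ) - i)⁻¹ •
      ∑ j ∈ V \ T, fun y : C => if insert j T ⊆ y.1 then (1 : ℚ) else 0 := by
    funext y
    simp only [Pi.smul_apply, Finset.sum_apply, smul_eq_mul, insert_subset_iff]
    by_cases h : T ⊆ y.1
    · have hset : (V \ T).filter (fun j => j ∈ y.1) = y.1 \ T := by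
        ext j
        have := @hV _ y.2 j
        simp only [mem_filter, mem_sdiff]
        tauto
      simp only [h, and_true, if_true, sum_boole, hset]
      rw [card_sdiff_of_subset h, hk _ y.2, hT, Nat.cast_sub hi.le, inv_mul_cancel₀ hpos]
    · simp [h]
  rw [key]
  refine Submodule.smul_mem _ _ (Submodule.sum_mem _ fun j hj => ?_)
  rw [mem_sdiff] at hj
  exact indicator_mem_inclusionSpan (insert_subset hj.1 hTV) (by rw [card_insert_of_notMem hj.2, hT])

theorem mul_inter_card_sub_mem_inclusionSpan (hV : ∀ x ∈ C, x ⊆ V) (hk : ∀ x ∈ C, x.card = k)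
    (hi : i < k) {x : Finset α} (hx : x ⊆ V) (l : ℚ) {g : C → ℚ} (hg : g ∈ inclusionSpan V C i) :
    (fun y : C => (((x ∩ y.1).card : ℚ) - l) * g y) ∈ inclusionSpan V C (i + 1) := by
  have hle := inclusionSpan_le_succ hV hk hi
  suffices h : inclusionSpan V C i ≤ (inclusionSpan V C (i + 1)).comap
      (LinearMap.mulLeft ℚ fun y : C => ((x ∩ y.1).card : ℚ) - l) from h hg
  refine Submodule.span_le.2 fun g hg => ?_
  simp only [coe_image, Set.mem_image, mem_coe, mem_powersetCard] at hg
  obtain ⟨T, ⟨hTV, hT⟩, rfl⟩ := hg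
  have key : ((fun y : C => ((x ∩ y.1).card : ℚ) - l) *
      fun y : C => if T ⊆ y.1 then (1 : ℚ) else 0) =
      (∑ j ∈ x, fun y : C => if insert j T ⊆ y.1 then (1 : ℚ) else 0) -
        l • fun y : C => if T ⊆ y.1 then (1 : ℚ) else 0 := by
    funext y
    simp only [Pi.smul_apply, Pi.mul_apply, Pi.sub_apply, Finset.sum_apply, smul_eq_mul,
      insert_subset_iff]
    by_cases h : T ⊆ y.1
    · simp [h]
    · simp [h]
  rw [SetLike.mem_coe, Submodule.mem_comap, LinearMap.mulLeft_apply, key]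
  refine Submodule.sub_mem _ (Submodule.sum_mem _ fun j hj => ?_)
    (Submodule.smul_mem _ _ (hle (indicator_mem_inclusionSpan hTV hT)))
  by_cases hjT : j ∈ T
  · rw [insert_eq_of_mem hjT]
    exact hle (indicator_mem_inclusionSpan hTV hT)
  · exact indicator_mem_inclusionSpan (insert_subset (hx hj) hTV)
      (by rw [card_insert_of_notMem hjT, hT])

theorem prod_inter_card_sub_mem_inclusionSpan (hV : ∀ x ∈ C, x ⊆ V) (hk : ∀ x ∈ C, x.card = k)
    {x : Finset α} (hx : x ⊆ V) (L : Finset ℕ) (hL : L.card ≤ k) :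
    (fun y : C => ∏ l ∈ L, (((x ∩ y.1).card : ℚ) - l)) ∈ inclusionSpan V C L.card := by
  induction L using Finset.induction_on with
  | empty => simpa using indicator_mem_inclusionSpan (C := C) (empty_subset V) card_empty
  | insert l L hl ih =>
    rw [card_insert_of_notMem hl] at hL ⊢
    simp only [prod_insert hl]
    exact mul_inter_card_sub_mem_inclusionSpan hV hk hL hx l (ih (by omega))

/-- The Ray-Chaudhuri–Wilson bound: a `k`-uniform family of subsets of `V` whose pairwise
intersection sizes lie in `L` has at most `V.card.choose L.card` members. -/
theorem card_le_choose_of_inter_card_mem (hV : ∀ x ∈ C, x ⊆ V) (hk : ∀ x ∈ C, x.card = k)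
    (L : Finset ℕ) (hL : L.card ≤ k) (hkL : k ∉ L)
    (hC : ∀ x ∈ C, ∀ y ∈ C, x ≠ y → (x ∩ y).card ∈ L) :
    C.card ≤ V.card.choose L.card := by
  have htop : inclusionSpan V C L.card = ⊤ := by
    rw [eq_top_iff, ← (Pi.basisFun ℚ C).span_eq, Submodule.span_le]
    rintro _ ⟨x, rfl⟩
    have hne : ∏ l ∈ L, ((k : ℚ) - l) ≠ 0 := prod_ne_zero_iff.2 fun l hl =>
      sub_ne_zero.2 fun h => hkL (by rwa [Nat.cast_injective h])
    have key : Pi.basisFun ℚ C x = (∏ l ∈ L, ((k : ℚ) - l))⁻¹ •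
        fun y : C => ∏ l ∈ L, (((x.1 ∩ y.1).card : ℚ) - l) := by
      funext y
      rw [Pi.basisFun_apply, Pi.smul_apply, smul_eq_mul]
      by_cases h : x = y
      · subst h
        rw [Pi.single_eq_same, inter_self, hk _ x.2, inv_mul_cancel₀ hne]
      · have hzero : ∏ l ∈ L, (((x.1 ∩ y.1).card : ℚ) - l) = 0 :=
          prod_eq_zero (hC _ x.2 _ y.2 fun e => h (Subtype.ext e)) (sub_self _)
        rw [Pi.single_eq_of_ne (Ne.symm h), hzero, mul_zero]
    rw [key]
    exact Submodule.smul_mem _ _ (prod_inter_card_sub_mem_inclusionSpan hV hk (hV _ x.2) L hL)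
  calc C.card = Module.finrank ℚ (inclusionSpan V C L.card) := by
        rw [htop, finrank_top, Module.finrank_fintype_fun_eq_card, Fintype.card_coe]
    _ ≤ _ := finrank_span_finset_le_card _
    _ ≤ (powersetCard L.card V).card := card_image_le
    _ = _ := card_powersetCard _ _

end

/-- A Johnson code (a family of `n`-subsets of `{1, …, 2n}`) with symmetric
distances and degree `s` has at most `C(2n − 1, s)` codewords. -/
theorem stmt_1 (n : ℕ) (hn : 0 < n) (C : Finset (Finset (Fin (2 * n))))
    (hcard : ∀ x ∈ C, x.card = n)
    (hsym : ∀ a ∈ johnsonDistSet n C, n - a ∈ johnsonDistSet n C) :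
    C.card ≤ (2 * n - 1).choose (johnsonDistSet n C).card := by
  have hdist : ∀ x ∈ C, ∀ y ∈ C, x ≠ y → n - (x ∩ y).card ∈ johnsonDistSet n C :=
    fun x hx y hy hxy => mem_image.2 ⟨(x, y), by simp [hx, hy, hxy], rfl⟩
  have hinter : ∀ x ∈ C, ∀ y ∈ C, x ≠ y → (x ∩ y).card ∈ johnsonDistSet n C := by
    intro x hx y hy hxy
    have hle := card_le_card (inter_subset_left : x ∩ y ⊆ x)
    rw [hcard x hx] at hle
    simpa [Nat.sub_sub_self hle] using hsym _ (hdist x hx y hy hxy)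
  have hnot : n ∉ johnsonDistSet n C := by
    intro h
    obtain ⟨⟨x, y⟩, hp, hxy⟩ := mem_image.1 (hsym n h)
    simp only [mem_filter, mem_product] at hp hxy
    obtain ⟨⟨hx, hy⟩, hne⟩ := hp
    have hle : n ≤ (x ∩ y).card := by omega
    have h₁ := eq_of_subset_of_card_le (inter_subset_left : x ∩ y ⊆ x) (by rwa [hcard x hx])
    have h₂ := eq_of_subset_of_card_le (inter_subset_right : x ∩ y ⊆ y) (by rwa [hcard y hy])
    exact hne (h₁.symm.trans h₂)
  have hlt : ∀ a ∈ johnsonDistSet n C, a < n := by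
    intro a ha
    refine lt_of_le_of_ne ?_ fun h => hnot (h ▸ ha)
    obtain ⟨p, -, rfl⟩ := mem_image.1 ha
    exact Nat.sub_le _ _
  have hS : (johnsonDistSet n C).card ≤ n := by
    simpa using card_le_card (fun a ha => mem_range.2 (hlt a ha) : johnsonDistSet n C ⊆ range n)
  have hcompl : ∀ x ∈ C, ∀ y ∈ C, x ≠ y → (xᶜ ∩ y).card ∈ johnsonDistSet n C := by
    intro x hx y hy hxy
    have h := card_sdiff_add_card_inter y x
    have he : xᶜ ∩ y = y \ x := by ext; simp [and_comm]
    rw [hcard y hy, inter_comm y x] at h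
    rw [he, show (y \ x).card = n - (x ∩ y).card by omega]
    exact hdist x hx y hy hxy
  let e : Fin (2 * n) := ⟨0, by omega⟩
  let φ : Finset (Fin (2 * n)) → Finset (Fin (2 * n)) := fun x => if e ∈ x then xᶜ else x
  have hφcard : ∀ x ∈ C, (φ x).card = n := by
    intro x hx
    have := hcard x hx
    simp only [φ]
    split_ifs
    · rw [card_compl, Fintype.card_fin]; omega
    · exact this
  have hφinter : ∀ x ∈ C, ∀ y ∈ C, x ≠ y → (φ x ∩ φ y).card ∈ johnsonDistSet n C := by
    intro x hx y hy hxy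
    simp only [φ]
    split_ifs
    · have h := card_union_add_card_inter x y
      have hle := card_le_univ (x ∪ y)
      rw [hcard x hx, hcard y hy] at h
      rw [Fintype.card_fin] at hle
      rw [← compl_union, card_compl, Fintype.card_fin,
        show 2 * n - (x ∪ y).card = (x ∩ y).card by omega]
      exact hinter x hx y hy hxy
    · exact hcompl x hx y hy hxy
    · rw [inter_comm]
      exact hcompl y hy x hx hxy.symm
    · exact hinter x hx y hy hxy
  have hφinj : Set.InjOn φ C := by
    intro x hx y hy h
    by_contra hxy
    have hmem := hφinter x hx y hy hxy
    rw [← h, inter_self, hφcard x hx] at hmem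
    exact hnot hmem
  have hbound := card_le_choose_of_inter_card_mem (C := C.image φ) (V := univ.erase e) (k := n)
    (by
      simp only [forall_mem_image]
      intro x _ j hj
      refine mem_erase.2 ⟨?_, mem_univ _⟩
      rintro rfl
      by_cases h : e ∈ x <;> simp [φ, h] at hj)
    (by simpa only [forall_mem_image] using hφcard) _ hS hnot
    (by
      simp only [forall_mem_image]
      exact fun x hx y hy hxy => hφinter x hx y hy fun h => hxy (h ▸ rfl))
  rwa [card_image_of_injOn hφinj, card_erase_of_mem (mem_univ _), card_univ,
    Fintype.card_fin] at hbound
end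

section
/- Let r, s be positive integers and set n = r + s. If there exists a Johnson code C with symmetric distances and degree s such that |C| = binom(2n−1, s) (a tight code), then the polynomial Φ_s(z) has s pairwise distinct integer zeros, and moreover every zero of Φ_s lies in the interval [1, r+s−1]. -/
open Finset Polynomial

/-- The coefficient `p_{s,i} = (C(s,i)/2^i) ⬝ (r+i−1)^{↓⌊i/2⌋} (r+1)^{↑i} / (r+1/2)^{↑⌊i/2⌋}`. -/
noncomputable def pcoef (r s i : ℕ) : ℚ :=
  (s.choose i : ℚ) / 2 ^ i *
    ((descPochhammer ℚ (i / 2)).eval ((r : ℚ) + i - 1) *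
      (ascPochhammer ℚ i).eval ((r : ℚ) + 1)) /
    (ascPochhammer ℚ (i / 2)).eval ((r : ℚ) + 1 / 2)

/-- The polynomial `Φ_s(z) = ∑_{i=0}^{s} (−1)^{s−i} z^{↓(s−i)} p_{s,i} ∈ ℚ[z]`. -/
noncomputable def Phi (r s : ℕ) : Polynomial ℚ :=
  ∑ i ∈ Finset.range (s + 1),
    Polynomial.C ((-1) ^ (s - i) * pcoef r s i) * descPochhammer ℚ (s - i)

theorem two_pow_mul_factorial_mul_ascPochhammer (ρ t : ℕ) :
    (4 : ℚ) ^ t * (ρ + t).factorial * (2 * ρ + 1).factorial *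
      (ascPochhammer ℚ t).eval ((ρ : ℚ) + 1 + 1 / 2) =
      ρ.factorial * (2 * ρ + 1 + 2 * t).factorial := by
  induction t with
  | zero => simp
  | succ t ih =>
    rw [ascPochhammer_succ_eval, show ρ + (t + 1) = ρ + t + 1 by ring,
      show 2 * ρ + 1 + 2 * (t + 1) = 2 * ρ + 1 + 2 * t + 1 + 1 by ring, Nat.factorial_succ (ρ + t),
      Nat.factorial_succ (2 * ρ + 1 + 2 * t + 1), Nat.factorial_succ (2 * ρ + 1 + 2 * t)]
    push_cast
    linear_combination (4 * ((ρ : ℚ) + t + 1) * (ρ + 1 + 1 / 2 + t)) * ih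

theorem descPochhammer_eval_mul_factorial (a t : ℕ) :
    (descPochhammer ℚ t).eval ((a + t : ℕ) : ℚ) * a.factorial = (a + t).factorial := by
  rw [descPochhammer_eval_eq_descFactorial]
  exact_mod_cast (by simpa [mul_comm] using Nat.factorial_mul_descFactorial (Nat.le_add_left t a))

theorem pcoef_eq_factorial (ρ s i : ℕ) :
    pcoef (ρ + 1) s i = s.choose i * (ρ + i).factorial * (ρ + 1 + i).factorial *
      (2 * ρ + 1).factorial /
        (ρ.factorial * (ρ + 1).factorial * (2 * ρ + 1 + i).factorial) := by
  have hasc : ((ρ + 1).factorial : ℚ) * (ascPochhammer ℚ i).eval (((ρ + 1 : ℕ) : ℚ) + 1) =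
      (ρ + 1 + i).factorial := factorial_mul_ascPochhammer ℚ (ρ + 1) i
  have hpos : 0 < (ascPochhammer ℚ (i / 2)).eval ((ρ : ℚ) + 1 + 1 / 2) :=
    ascPochhammer_pos _ _ (by positivity)
  obtain ⟨t, rfl | rfl⟩ := Nat.even_or_odd' i
  · have h1 := two_pow_mul_factorial_mul_ascPochhammer ρ t
    have h2 := descPochhammer_eval_mul_factorial (ρ + t) t
    rw [Nat.mul_div_cancel_left t two_pos] at hpos
    rw [pcoef, Nat.mul_div_cancel_left t two_pos,
      show ((ρ + 1 : ℕ) : ℚ) + (2 * t : ℕ) - 1 = ((ρ + t + t : ℕ) : ℚ) by push_cast; ring,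
      show ρ + 2 * t = ρ + t + t by ring, ← h2, ← hasc, pow_mul]
    push_cast at h1 ⊢
    norm_num only at h1 hpos ⊢
    rw [div_eq_div_iff (by positivity) (by positivity)]
    rw [div_mul_eq_mul_div, div_mul_eq_mul_div, div_eq_iff (by positivity)]
    linear_combination -((s.choose (2 * t) : ℚ) * eval (ρ + t + t : ℚ) (descPochhammer ℚ t) *
      eval ((ρ : ℚ) + 1 + 1) (ascPochhammer ℚ (2 * t)) * (ρ + 1).factorial) * h1
  · have h1 := two_pow_mul_factorial_mul_ascPochhammer ρ t
    have h2 := descPochhammer_eval_mul_factorial (ρ + t + 1) t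
    have ht : (2 * t + 1) / 2 = t := by lia
    rw [ht] at hpos
    rw [pcoef, ht,
      show ((ρ + 1 : ℕ) : ℚ) + (2 * t + 1 : ℕ) - 1 = ((ρ + t + 1 + t : ℕ) : ℚ) by push_cast; ring,
      show ρ + (2 * t + 1) = ρ + t + 1 + t by ring, ← h2, ← hasc, pow_succ, pow_mul,
      show 2 * ρ + 1 + (2 * t + 1) = 2 * ρ + 1 + 2 * t + 1 by ring,
      Nat.factorial_succ (2 * ρ + 1 + 2 * t), Nat.factorial_succ (ρ + t)]
    push_cast at h1 ⊢
    norm_num only at h1 hpos ⊢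
    rw [div_eq_div_iff (by positivity) (by positivity)]
    rw [div_mul_eq_mul_div, div_mul_eq_mul_div, div_eq_iff (by positivity)]
    linear_combination -((s.choose (2 * t + 1) : ℚ) *
      eval (ρ + t + 1 + t : ℚ) (descPochhammer ℚ t) * (2 * ρ + 2 * t + 2) *
      eval ((ρ : ℚ) + 1 + 1) (ascPochhammer ℚ (2 * t + 1)) * (ρ + 1).factorial) * h1

theorem sum_neg_one_pow_mul_choose_mul_eval {P : ℚ[X]} {s : ℕ} (hP : P.natDegree < s) :
    ∑ i ∈ range (s + 1), (-1 : ℚ) ^ (s - i) * s.choose i * P.eval (i : ℚ) = 0 := by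
  have h := congrFun (Polynomial.fwdDiff_iter_eq_zero_of_degree_lt hP) 0
  rw [fwdDiff_iter_eq_sum_shift] at h
  simpa using h

theorem choose_mul_descFactorial_mul_descFactorial (N j m q : ℕ) :
    N.choose (m + q) * ((m + q).descFactorial m * (N - (m + q)).descFactorial j) =
      N.descFactorial (m + j) * (N - m - j).choose q := by
  by_cases h : m + q + j ≤ N
  · obtain ⟨p, rfl⟩ := Nat.exists_eq_add_of_le h
    have h1 := Nat.add_choose_mul_factorial_mul_factorial (m + q) (j + p)
    rw [← Nat.choose_symm_add] at h1
    have h2 := Nat.factorial_mul_descFactorial (Nat.le_add_right m q)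
    have h3 := Nat.factorial_mul_descFactorial (Nat.le_add_right j p)
    have h4 := Nat.factorial_mul_descFactorial (show m + j ≤ m + q + j + p by lia)
    have h5 := Nat.add_choose_mul_factorial_mul_factorial q p
    rw [← Nat.choose_symm_add] at h5
    rw [show m + q - m = q by lia] at h2
    rw [show j + p - j = p by lia] at h3
    rw [show m + q + j + p - (m + j) = q + p by lia] at h4
    rw [show m + q + j + p - (m + q) = j + p by lia,
      show m + q + j + p - m - j = q + p by lia]
    rw [← add_assoc (m + q), ← h2, ← h3, ← h4, ← h5] at h1
    have hpos : 0 < q.factorial * p.factorial := by positivity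
    refine Nat.eq_of_mul_eq_mul_right hpos ?_
    linear_combination h1
  · have hl : N.choose (m + q) * ((m + q).descFactorial m * (N - (m + q)).descFactorial j) = 0 := by
      by_cases h' : N < m + q
      · simp [Nat.choose_eq_zero_of_lt h']
      · simp [Nat.descFactorial_of_lt (show N - (m + q) < j by lia)]
    rw [hl]
    by_cases h' : N < m + j
    · simp [Nat.descFactorial_of_lt h']
    · simp [Nat.choose_eq_zero_of_lt (show N - m - j < q by lia)]

theorem sum_choose_mul_choose_mul_descFactorial (N j m q : ℕ) (hq : m + q = N + 1) :
    ∑ k ∈ range (N + 2), N.choose k * N.choose (N + 1 - k) *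
      ((N - k).descFactorial j * k.descFactorial m) =
      N.descFactorial (m + j) * (N - m - j + N).choose q := by
  rw [show N + 2 = m + (q + 1) by lia, Finset.sum_range_add, Finset.sum_eq_zero, zero_add,
    Nat.add_choose_eq, Finset.Nat.sum_antidiagonal_eq_sum_range_succ_mk, Finset.mul_sum]
  · refine Finset.sum_congr rfl fun k hk => ?_
    have h := choose_mul_descFactorial_mul_descFactorial N j m k
    rw [show N + 1 - (m + k) = q - k by lia]
    dsimp only
    linear_combination N.choose (q - k) * h
  · intro k hk
    simp [Nat.descFactorial_of_lt (Finset.mem_range.1 hk)]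

theorem eval_Phi (r s k : ℕ) :
    (Phi r s).eval (k : ℚ) =
      ∑ i ∈ range (s + 1), (-1) ^ (s - i) * pcoef r s i * k.descFactorial (s - i) := by
  simp [Phi, eval_finsetSum, descPochhammer_eval_eq_descFactorial]

theorem pcoef_mul_descFactorial_mul_choose (ρ j u i m N : ℕ) (hm : m + i = j + 1 + u)
    (hN : N = ρ + (j + 1 + u)) :
    pcoef (ρ + 1) (j + 1 + u) i * (N.descFactorial (m + j) * (N - m - j + N).choose (ρ + 1 + i)) =
      ((2 * ρ + 1).factorial * N.factorial / (ρ.factorial * (ρ + 1).factorial * (ρ + u).factorial)) *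
        ((j + 1 + u).choose i * ((descPochhammer ℚ j).eval ((i : ℚ) + ρ) *
          (ascPochhammer ℚ u).eval ((i : ℚ) + (2 * ρ + 2)))) := by
  have hNm : N - m = ρ + i := by lia
  have h1 : N.descFactorial (m + j) = N.descFactorial m * (ρ + i).descFactorial j := by
    rw [← Nat.descFactorial_mul_descFactorial (Nat.le_add_right m j), hNm,
      Nat.add_sub_cancel_left, mul_comm]
  have h2 : ((ρ + i).factorial : ℚ) * N.descFactorial m = N.factorial := by
    rw [← hNm]
    exact_mod_cast Nat.factorial_mul_descFactorial (show m ≤ N by lia)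
  by_cases hj : ρ + i < j
  · have : (descPochhammer ℚ j).eval ((i : ℚ) + ρ) = 0 := by
      rw [add_comm, ← Nat.cast_add, descPochhammer_eval_eq_descFactorial,
        Nat.descFactorial_of_lt hj, Nat.cast_zero]
    simp [this, h1, Nat.descFactorial_of_lt hj]
  have h3 : ((N - m - j + N).choose (ρ + 1 + i) : ℚ) * (ρ + 1 + i).factorial * (ρ + u).factorial =
      (2 * ρ + 1 + i + u).factorial := by
    rw [show N - m - j + N = (ρ + 1 + i) + (ρ + u) by lia,
      show 2 * ρ + 1 + i + u = (ρ + 1 + i) + (ρ + u) by ring, Nat.choose_symm_add]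
    exact_mod_cast Nat.add_choose_mul_factorial_mul_factorial (ρ + 1 + i) (ρ + u)
  have h4 := factorial_mul_ascPochhammer ℚ (2 * ρ + 1 + i) u
  have h5 : (descPochhammer ℚ j).eval ((i : ℚ) + ρ) = (ρ + i).descFactorial j := by
    rw [← descPochhammer_eval_eq_descFactorial, Nat.cast_add, add_comm]
  rw [h5, pcoef_eq_factorial, h1, ← h2,
    show (i : ℚ) + (2 * ρ + 2) = ((2 * ρ + 1 + i : ℕ) : ℚ) + 1 by push_cast; ring]
  rw [← h4] at h3
  set A := (ascPochhammer ℚ u).eval (((2 * ρ + 1 + i : ℕ) : ℚ) + 1)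
  have e1 : ((2 * ρ + 1 + i).factorial : ℚ) ≠ 0 := by positivity
  have e2 : ((ρ + u).factorial : ℚ) ≠ 0 := by positivity
  have e3 : (ρ.factorial : ℚ) ≠ 0 := by positivity
  have e4 : ((ρ + 1).factorial : ℚ) ≠ 0 := by positivity
  push_cast
  field_simp
  linear_combination ((j + 1 + u).choose i * N.descFactorial m * (ρ + i).descFactorial j : ℚ) * h3

theorem sum_choose_mul_descPochhammer_mul_Phi (ρ j u N : ℕ) (hN : N = ρ + (j + 1 + u)) :
    ∑ k ∈ range (N + 2), (N.choose k * N.choose (N + 1 - k) : ℚ) *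
      ((descPochhammer ℚ j).eval ((N : ℚ) - k) * (Phi (ρ + 1) (j + 1 + u)).eval (k : ℚ)) = 0 := by
  have key : ∀ k ∈ range (N + 2), (N.choose k * N.choose (N + 1 - k) : ℚ) *
      ((descPochhammer ℚ j).eval ((N : ℚ) - k) * (Phi (ρ + 1) (j + 1 + u)).eval (k : ℚ)) =
      ∑ i ∈ range (j + 1 + u + 1), (-1) ^ (j + 1 + u - i) * pcoef (ρ + 1) (j + 1 + u) i *
        ((N.choose k * N.choose (N + 1 - k) * ((N - k).descFactorial j *
          k.descFactorial (j + 1 + u - i)) : ℕ) : ℚ) := by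
    intro k hk
    rw [Finset.mem_range] at hk
    obtain rfl | hk' : k = N + 1 ∨ k ≤ N := by lia
    · simp
    · rw [eval_Phi, ← Nat.cast_sub hk', descPochhammer_eval_eq_descFactorial, Finset.mul_sum,
        Finset.mul_sum]
      refine Finset.sum_congr rfl fun i _ => ?_
      push_cast
      ring
  rw [Finset.sum_congr rfl key, Finset.sum_comm]
  simp_rw [← Finset.mul_sum, ← Nat.cast_sum]
  set c : ℚ := (2 * ρ + 1).factorial * N.factorial /
    (ρ.factorial * (ρ + 1).factorial * (ρ + u).factorial)
  set P : ℚ[X] := (descPochhammer ℚ j).comp (X + Polynomial.C (ρ : ℚ)) *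
    (ascPochhammer ℚ u).comp (X + Polynomial.C (2 * ρ + 2 : ℚ))
  have hP : P.natDegree < j + 1 + u := by
    refine (natDegree_mul_le).trans_lt ?_
    rw [natDegree_comp, natDegree_comp, natDegree_X_add_C, natDegree_X_add_C,
      descPochhammer_natDegree, ascPochhammer_natDegree]
    lia
  rw [← mul_zero c, ← sum_neg_one_pow_mul_choose_mul_eval hP, Finset.mul_sum]
  refine Finset.sum_congr rfl fun i hi => ?_
  rw [Finset.mem_range] at hi
  rw [sum_choose_mul_choose_mul_descFactorial N j (j + 1 + u - i) (ρ + 1 + i) (by lia),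
    mul_assoc, Nat.cast_mul,
    pcoef_mul_descFactorial_mul_choose ρ j u i (j + 1 + u - i) N (by lia) hN]
  simp only [P, eval_mul, eval_comp, eval_add, eval_X, eval_C]
  ring

/-- A subspace of polynomials containing one polynomial of every degree below `m` contains every
polynomial of degree below `m`. -/
theorem mem_of_degree_lt_of_forall_exists_degree_eq {K : Type*} [Field K] (W : Submodule K K[X])
    (m : ℕ) (hW : ∀ j < m, ∃ p ∈ W, p.degree = j) (L : K[X]) (hL : L.degree < m) : L ∈ W := by
  induction m generalizing L with
  | zero =>
    rw [Nat.cast_zero, Nat.WithBot.lt_zero_iff, degree_eq_bot] at hL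
    simp [hL]
  | succ m ih =>
    obtain ⟨p, hpW, hp⟩ := hW m (Nat.lt_succ_self m)
    have hc : p.coeff m ≠ 0 := coeff_ne_zero_of_eq_degree hp
    have hLp : L - (L.coeff m / p.coeff m) • p ∈ W := by
      refine ih (fun j hj => hW j (hj.trans (Nat.lt_succ_self m))) _ ?_
      rw [degree_lt_iff_coeff_zero] at hL ⊢
      intro a ha
      obtain rfl | ha' := ha.eq_or_lt
      · simp [div_mul_cancel₀ _ hc]
      · have : p.coeff a = 0 := coeff_eq_zero_of_degree_lt (by rw [hp]; exact_mod_cast ha')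
        simp [this, hL a ha']
    simpa using W.add_mem hLp (W.smul_mem (L.coeff m / p.coeff m) hpW)

theorem sum_mul_eval_eq_zero_of_degree_lt (I : Finset ℕ) (c : ℕ → ℚ) (m : ℕ)
    (h : ∀ j < m, ∃ p : ℚ[X], p.degree = j ∧ ∑ k ∈ I, c k * p.eval (k : ℚ) = 0)
    (L : ℚ[X]) (hL : L.degree < m) : ∑ k ∈ I, c k * L.eval (k : ℚ) = 0 := by
  let φ : ℚ[X] →ₗ[ℚ] ℚ := ∑ k ∈ I, c k • Polynomial.leval (k : ℚ)
  have hφ : ∀ p : ℚ[X], φ p = ∑ k ∈ I, c k * p.eval (k : ℚ) := by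
    intro p
    simp [φ, LinearMap.sum_apply, leval_apply]
  rw [← hφ, ← LinearMap.mem_ker]
  refine mem_of_degree_lt_of_forall_exists_degree_eq _ m (fun j hj => ?_) L hL
  obtain ⟨p, hp, hp'⟩ := h j hj
  exact ⟨p, by rw [LinearMap.mem_ker, hφ, hp'], hp⟩

theorem sum_choose_mul_Phi_mul_eval (ρ s : ℕ) (L : ℚ[X]) (hL : L.degree < s) :
    ∑ k ∈ range (ρ + s + 2), ((ρ + s).choose k * (ρ + s).choose (ρ + s + 1 - k) : ℚ) *
      (Phi (ρ + 1) s).eval (k : ℚ) * L.eval (k : ℚ) = 0 := by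
  refine sum_mul_eval_eq_zero_of_degree_lt _ _ s (fun j hj => ?_) L hL
  obtain ⟨u, rfl⟩ : ∃ u, s = j + 1 + u := Nat.exists_eq_add_of_le hj
  have hd : (Polynomial.C ((ρ + (j + 1 + u) : ℕ) : ℚ) - X).natDegree = 1 := by
    rw [← neg_sub, natDegree_neg, natDegree_X_sub_C]
  refine ⟨(descPochhammer ℚ j).comp (Polynomial.C ((ρ + (j + 1 + u) : ℕ) : ℚ) - X), ?_, ?_⟩
  · have hn : ((descPochhammer ℚ j).comp
        (Polynomial.C ((ρ + (j + 1 + u) : ℕ) : ℚ) - X)).natDegree = j := by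
      rw [natDegree_comp, hd, descPochhammer_natDegree, mul_one]
    rw [degree_eq_natDegree, hn]
    intro h0
    rw [← leadingCoeff_eq_zero, leadingCoeff_comp (by rw [hd]; exact one_ne_zero),
      (monic_descPochhammer ℚ j).leadingCoeff, one_mul, ← neg_sub, leadingCoeff_neg,
      leadingCoeff_X_sub_C] at h0
    simp at h0
  · rw [← sum_choose_mul_descPochhammer_mul_Phi ρ j u _ rfl]
    refine Finset.sum_congr rfl fun k _ => ?_
    simp only [eval_comp, eval_sub, eval_C, eval_X]
    ring

section Interpolation

variable {α : Type*} [DecidableEq α]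

theorem sum_powersetCard_choose_card_inter (x y : Finset α) (s i : ℕ) (hi : i ≤ s) :
    ∑ T ∈ y.powersetCard s, (T ∩ x).card.choose i =
      (x ∩ y).card.choose i * (y.card - i).choose (s - i) := by
  have h : ∀ T ∈ y.powersetCard s, (T ∩ x).card.choose i =
      ∑ U ∈ (x ∩ y).powersetCard i, if U ⊆ T then 1 else 0 := by
    intro T hT
    rw [Finset.mem_powersetCard] at hT
    rw [← Finset.card_powersetCard, ← Finset.sum_filter, Finset.card_eq_sum_ones]
    refine Finset.sum_congr ?_ fun _ _ => rfl
    ext U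
    simp only [Finset.mem_powersetCard, Finset.mem_filter, Finset.subset_inter_iff]
    exact ⟨fun h => ⟨⟨⟨h.1.2, h.1.1.trans hT.1⟩, h.2⟩, h.1.1⟩,
      fun h => ⟨⟨h.2, h.1.1.1⟩, h.1.2⟩⟩
  rw [Finset.sum_congr rfl h, Finset.sum_comm, ← Finset.card_powersetCard i (x ∩ y),
    ← smul_eq_mul, ← Finset.sum_const]
  refine Finset.sum_congr rfl fun U hU => ?_
  rw [Finset.mem_powersetCard] at hU
  rw [← Finset.sum_filter, ← Finset.card_eq_sum_ones, Finset.card_filter_powersetCard_subset _ _ _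
    (hU.1.trans Finset.inter_subset_right) (hU.2.trans_le hi), hU.2]

theorem exists_eval_card_inter_eq_sum (n s : ℕ) (hs : s ≤ n) (L : ℚ[X]) (hL : L.natDegree ≤ s) :
    ∃ φ : ℕ → ℚ, ∀ x y : Finset α, y.card = n →
      L.eval ((x ∩ y).card : ℚ) = ∑ T ∈ y.powersetCard s, φ (T ∩ x).card := by
  let W : Submodule ℚ ℚ[X] :=
    { carrier := {L | ∃ φ : ℕ → ℚ, ∀ x y : Finset α, y.card = n →
        L.eval ((x ∩ y).card : ℚ) = ∑ T ∈ y.powersetCard s, φ (T ∩ x).card}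
      add_mem' := by
        rintro a b ⟨φ, hφ⟩ ⟨ψ, hψ⟩
        exact ⟨φ + ψ, fun x y hy => by
          simp [hφ x y hy, hψ x y hy, Finset.sum_add_distrib]⟩
      zero_mem' := ⟨0, by simp⟩
      smul_mem' := by
        rintro c a ⟨φ, hφ⟩
        exact ⟨c • φ, fun x y hy => by simp [hφ x y hy, Finset.mul_sum]⟩ }
  refine mem_of_degree_lt_of_forall_exists_degree_eq W (s + 1) (fun i hi => ?_) L
    ((degree_le_of_natDegree_le hL).trans_lt (by exact_mod_cast Nat.lt_succ_self s))
  refine ⟨descPochhammer ℚ i, ?_, ?_⟩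
  · refine ⟨fun k => i.factorial * k.choose i / (n - i).choose (s - i), fun x y hy => ?_⟩
    have hpos : ((n - i).choose (s - i) : ℚ) ≠ 0 := by
      exact_mod_cast (Nat.choose_pos (by lia)).ne'
    have h := sum_powersetCard_choose_card_inter x y s i (by lia)
    rw [hy] at h
    rw [← Finset.sum_div, ← Finset.mul_sum, eq_div_iff hpos,
      descPochhammer_eval_eq_descFactorial, Nat.descFactorial_eq_factorial_mul_choose,
      ← Nat.cast_sum, h]
    push_cast
    ring
  · rw [degree_eq_natDegree (monic_descPochhammer ℚ i).ne_zero, descPochhammer_natDegree]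

/-- The monomial `T ⊆ y`, extended from the sets avoiding `e` to all sets so that complementation
acts by `(-1) ^ s`. -/
def parityMonomial [Fintype α] (s : ℕ) (e : α) (T y : Finset α) : ℚ :=
  if e ∈ y then (-1) ^ s * (if T ⊆ yᶜ then 1 else 0) else if T ⊆ y then 1 else 0

variable [Fintype α]

theorem sum_powersetCard_erase_ite {s : ℕ} {e : α} {y : Finset α} (he : e ∉ y)
    (f : Finset α → ℚ) :
    ∑ T ∈ (univ.erase e).powersetCard s, f T * (if T ⊆ y then 1 else 0) =
      ∑ T ∈ y.powersetCard s, f T := by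
  simp only [mul_ite, mul_one, mul_zero]
  rw [← Finset.sum_filter]
  refine Finset.sum_congr ?_ fun _ _ => rfl
  ext T
  simp only [Finset.mem_filter, Finset.mem_powersetCard]
  exact ⟨fun h => ⟨h.2, h.1.2⟩, fun h => ⟨⟨fun a ha => Finset.mem_erase.2
    ⟨fun hae => he (hae ▸ h.1 ha), Finset.mem_univ a⟩, h.2⟩, h.1⟩⟩

theorem exists_eval_johnsonDist_eq_sum_parityMonomial {n s : ℕ} (hα : Fintype.card α = 2 * n)
    (hs : s ≤ n) (e : α) {P : ℚ[X]} (hP : P.natDegree ≤ s)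
    (hpar : ∀ t : ℚ, P.eval (n - t) = (-1) ^ s * P.eval t) :
    ∃ φ : ℕ → ℚ, ∀ x y : Finset α, x.card = n → y.card = n →
      P.eval ((n - (x ∩ y).card : ℕ) : ℚ) =
        ∑ T ∈ (univ.erase e).powersetCard s, φ (T ∩ x).card * parityMonomial s e T y := by
  obtain ⟨φ, hφ⟩ := exists_eval_card_inter_eq_sum (α := α) n s hs
    (P.comp (Polynomial.C (n : ℚ) - X)) (by
      refine natDegree_comp_le.trans ?_
      rw [← neg_sub, natDegree_neg, natDegree_X_sub_C, mul_one]
      exact hP)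
  simp only [eval_comp, eval_sub, eval_C, eval_X] at hφ
  refine ⟨φ, fun x y hx hy => ?_⟩
  have hle : (x ∩ y).card ≤ n := hx ▸ Finset.card_le_card Finset.inter_subset_left
  by_cases he : e ∈ y
  · have hyc : yᶜ.card = n := by rw [Finset.card_compl, hα, hy]; lia
    have hxy : (x ∩ yᶜ).card = n - (x ∩ y).card := by
      have := Finset.card_inter_add_card_sdiff x y
      rw [← Finset.sdiff_eq_inter_compl]
      lia
    have h := hφ x yᶜ hyc
    rw [hpar, hxy] at h
    simp only [parityMonomial, he, if_true]
    simp_rw [mul_left_comm _ ((-1 : ℚ) ^ s)]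
    rw [← Finset.mul_sum, sum_powersetCard_erase_ite (by simpa using he) fun T => φ (T ∩ x).card,
      ← h, ← mul_assoc, ← mul_pow]
    simp
  · simp only [parityMonomial, he, if_false]
    rw [sum_powersetCard_erase_ite he fun T => φ (T ∩ x).card, ← hφ x y hy, Nat.cast_sub hle]

/-- If a space `V` of functions has dimension at most `|C|` and contains functions `f x`, `x ∈ C`,
that are a nonzero multiple of the Kronecker delta on `C`, then these interpolate `V`. -/
theorem eq_sum_of_finrank_le_card {β : Type*} [Finite β] (V : Submodule ℚ (β → ℚ)) (C : Finset β)
    (hV : Module.finrank ℚ V ≤ C.card) (f : β → β → ℚ) (hfV : ∀ x ∈ C, f x ∈ V) (a : ℚ)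
    (ha : a ≠ 0) (hf : ∀ x ∈ C, f x x = a) (hf' : ∀ x ∈ C, ∀ y ∈ C, x ≠ y → f x y = 0)
    {g : β → ℚ} (hg : g ∈ V) (z : β) : a * g z = ∑ x ∈ C, g x * f x z := by
  let ρ : V →ₗ[ℚ] (C → ℚ) := (LinearMap.funLeft ℚ ℚ ((↑) : C → β)).comp V.subtype
  have hval : ∀ (g : β → ℚ), ∀ y ∈ C, ∑ x ∈ C, g x * f x y = a * g y := by
    intro g y hy
    rw [Finset.sum_eq_single_of_mem y hy fun x hx hxy => by rw [hf' x hx y hy hxy, mul_zero],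
      hf y hy, mul_comm]
  have hmem : ∀ (g : β → ℚ), ∑ x ∈ C, g x • f x ∈ V := fun g =>
    V.sum_mem fun x hx => V.smul_mem _ (hfV x hx)
  have hsurj : Function.Surjective ρ := by
    intro h
    let h' : β → ℚ := Function.extend ((↑) : C → β) h 0
    refine ⟨a⁻¹ • ⟨_, hmem h'⟩, ?_⟩
    ext ⟨y, hy⟩
    have : h' y = h ⟨y, hy⟩ := Subtype.val_injective.extend_apply h 0 ⟨y, hy⟩
    simp [ρ, LinearMap.funLeft_apply, hval h' y hy, this, ha]
  have hfin : Module.finrank ℚ V = Module.finrank ℚ (C → ℚ) := by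
    refine le_antisymm (by simpa using hV) (LinearMap.finrank_le_finrank_of_surjective hsurj)
  have hinj := (LinearMap.injective_iff_surjective_of_finrank_eq_finrank hfin).2 hsurj
  have heq : (⟨a • g, V.smul_mem a hg⟩ : V) = ⟨_, hmem g⟩ := by
    apply hinj
    ext ⟨y, hy⟩
    simp [ρ, LinearMap.funLeft_apply, hval g y hy]
  have := congrFun (congrArg Subtype.val heq) z
  simpa using this

theorem sum_eval_johnsonDist_mul_of_tight {n s : ℕ} (hα : Fintype.card α = 2 * n) (hn : 0 < n)
    (hs : s ≤ n) {A P : ℚ[X]} (hA : A.natDegree ≤ s)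
    (hApar : ∀ t : ℚ, A.eval (n - t) = (-1) ^ s * A.eval t) (hP : P.natDegree ≤ s)
    (hPpar : ∀ t : ℚ, P.eval (n - t) = (-1) ^ s * P.eval t) (C : Finset (Finset α))
    (hC : ∀ x ∈ C, x.card = n) (hcard : C.card = (2 * n - 1).choose s) (hA0 : A.eval 0 ≠ 0)
    (hAC : ∀ x ∈ C, ∀ y ∈ C, x ≠ y → A.eval ((n - (x ∩ y).card : ℕ) : ℚ) = 0)
    (z : Finset α) (hz : z.card = n) :
    ∑ x ∈ C, P.eval ((n - (z ∩ x).card : ℕ) : ℚ) * A.eval ((n - (x ∩ z).card : ℕ) : ℚ) =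
      A.eval 0 * P.eval 0 := by
  obtain ⟨e⟩ : Nonempty α := Fintype.card_pos_iff.1 (by lia)
  obtain ⟨φ, hφ⟩ := exists_eval_johnsonDist_eq_sum_parityMonomial hα hs e hA hApar
  obtain ⟨ψ, hψ⟩ := exists_eval_johnsonDist_eq_sum_parityMonomial hα hs e hP hPpar
  let β := {y : Finset α // y.card = n}
  let b : (univ.erase e).powersetCard s → β → ℚ := fun T y => parityMonomial s e T y
  let V : Submodule ℚ (β → ℚ) := Submodule.span ℚ (Set.range b)
  have hmem : ∀ (Q : ℚ[X]) (χ : ℕ → ℚ), (∀ x y : Finset α, x.card = n → y.card = n →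
      Q.eval ((n - (x ∩ y).card : ℕ) : ℚ) =
        ∑ T ∈ (univ.erase e).powersetCard s, χ (T ∩ x).card * parityMonomial s e T y) →
      ∀ x : β, (fun y : β => Q.eval ((n - (x.1 ∩ y.1).card : ℕ) : ℚ)) ∈ V := by
    intro Q χ hχ x
    have : (fun y : β => Q.eval ((n - (x.1 ∩ y.1).card : ℕ) : ℚ)) =
        ∑ T : (univ.erase e).powersetCard s, χ (T.1 ∩ x.1).card • b T := by
      ext y
      rw [hχ x y x.2 y.2, ← Finset.sum_coe_sort]
      simp [b]
    rw [this]
    exact V.sum_mem fun T _ => V.smul_mem _ (Submodule.subset_span ⟨T, rfl⟩)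
  let D : Finset β := C.subtype fun y => y.card = n
  have hDC : D.map (Function.Embedding.subtype _) = C := by
    rw [Finset.subtype_map, Finset.filter_true_of_mem hC]
  have hV : Module.finrank ℚ V ≤ D.card := by
    refine (finrank_range_le_card b).trans_eq ?_
    rw [← Finset.card_map (Function.Embedding.subtype _), hDC, hcard, Fintype.card_coe,
      Finset.card_powersetCard, Finset.card_erase_of_mem (Finset.mem_univ e), Finset.card_univ, hα]
  have hself : ∀ y : β, (n - (y.1 ∩ y.1).card : ℕ) = 0 := fun y => by
    rw [Finset.inter_self, y.2, Nat.sub_self]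
  have h := eq_sum_of_finrank_le_card V D hV
    (fun x y => A.eval ((n - (x.1 ∩ y.1).card : ℕ) : ℚ)) (fun x _ => hmem A φ hφ x) (A.eval 0) hA0
    (fun x _ => by simp only [hself x, Nat.cast_zero])
    (fun x hx y hy hxy => hAC x (Finset.mem_subtype.1 hx) y (Finset.mem_subtype.1 hy)
      fun h => hxy (Subtype.ext h))
    (hmem P ψ hψ ⟨z, hz⟩) ⟨z, hz⟩
  rw [← hDC, Finset.sum_map]
  simpa [hself ⟨z, hz⟩, hz] using h.symm

theorem sum_powersetCard_comp_card_inter {n : ℕ} (hα : Fintype.card α = 2 * n) (x : Finset α)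
    (hx : x.card = n) (h : ℕ → ℚ) :
    ∑ z ∈ (univ : Finset α).powersetCard n, h (n - (x ∩ z).card) =
      ∑ k ∈ range (n + 1), (n.choose k * n.choose (n - k) : ℚ) * h k := by
  have hxc : xᶜ.card = n := by rw [Finset.card_compl, hα, hx]; lia
  have hmaps : ∀ z ∈ (univ : Finset α).powersetCard n, n - (x ∩ z).card ∈ range (n + 1) :=
    fun z _ => Finset.mem_range.2 (by lia)
  rw [← Finset.sum_fiberwise_of_maps_to hmaps]
  refine Finset.sum_congr rfl fun k hk => ?_
  rw [Finset.mem_range] at hk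
  rw [Finset.sum_congr rfl (g := fun _ => h k) fun z hz => by rw [(Finset.mem_filter.1 hz).2],
    Finset.sum_const, nsmul_eq_mul]
  congr 1
  have : (x.powersetCard (n - k) ×ˢ xᶜ.powersetCard k).card = n.choose (n - k) * n.choose k := by
    rw [Finset.card_product, Finset.card_powersetCard, Finset.card_powersetCard, hx, hxc]
  rw [mul_comm, ← Nat.cast_mul, ← this, Nat.cast_inj]
  refine Finset.card_nbij' (fun z => (x ∩ z, xᶜ ∩ z)) (fun p => p.1 ∪ p.2) ?_ ?_ ?_ ?_
  · intro z hz
    simp only [Finset.coe_filter, Finset.mem_powersetCard, Set.mem_ofPred_eq] at hz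
    have h1 := Finset.card_inter_add_card_sdiff z x
    have h2 : (x ∩ z).card ≤ x.card := Finset.card_le_card Finset.inter_subset_left
    rw [Finset.sdiff_eq_inter_compl, Finset.inter_comm z, Finset.inter_comm z] at h1
    simp only [Finset.coe_product, Set.mem_prod, Finset.mem_coe, Finset.mem_powersetCard,
      Finset.inter_subset_left, true_and]
    lia
  · rintro ⟨p, q⟩ hpq
    simp only [Finset.coe_product, Set.mem_prod, Finset.mem_coe, Finset.mem_powersetCard] at hpq
    obtain ⟨⟨hp, hpc⟩, hq, hqc⟩ := hpq
    have hd : Disjoint x q := Finset.disjoint_left.2 fun a ha haq =>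
      (Finset.mem_compl.1 (hq haq)) ha
    simp only [Finset.coe_filter, Finset.mem_powersetCard, Set.mem_ofPred_eq, Finset.subset_univ,
      true_and]
    rw [Finset.card_union_of_disjoint (Finset.disjoint_of_subset_left hp hd),
      Finset.inter_union_distrib_left, Finset.disjoint_iff_inter_eq_empty.1 hd,
      Finset.union_empty, Finset.inter_eq_right.2 hp]
    lia
  · intro z _
    simp only
    rw [← Finset.union_inter_distrib_right, Finset.union_compl, Finset.univ_inter]
  · rintro ⟨p, q⟩ hpq
    simp only [Finset.coe_product, Set.mem_prod, Finset.mem_coe, Finset.mem_powersetCard] at hpq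
    obtain ⟨⟨hp, hpc⟩, hq, hqc⟩ := hpq
    have h1 : ∀ a ∈ p, a ∈ x := fun a ha => hp ha
    have h2 : ∀ a ∈ q, a ∉ x := fun a ha => Finset.mem_compl.1 (hq ha)
    ext a <;> simp <;> grind

end Interpolation

theorem sum_choose_mul_eval_mul_eval_of_tight {α : Type*} [Fintype α] [DecidableEq α] {N s : ℕ}
    (hα : Fintype.card α = 2 * (N + 1)) (hs : s ≤ N + 1) {A : ℚ[X]} (hA : A.natDegree ≤ s)
    (hApar : ∀ t : ℚ, A.eval (((N + 1 : ℕ) : ℚ) - t) = (-1) ^ s * A.eval t)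
    (C : Finset (Finset α)) (hC : ∀ x ∈ C, x.card = N + 1)
    (hcard : C.card = (2 * (N + 1) - 1).choose s) (hA0 : A.eval 0 ≠ 0)
    (hAC : ∀ x ∈ C, ∀ y ∈ C, x ≠ y → A.eval ((N + 1 - (x ∩ y).card : ℕ) : ℚ) = 0)
    (L : ℚ[X]) (hL : L.degree < s) :
    ∑ k ∈ range (N + 2), (N.choose k * N.choose (N + 1 - k) : ℚ) * A.eval (k : ℚ) *
      L.eval (k : ℚ) = 0 := by
  have hC0 : (C.card : ℚ) ≠ 0 := by
    rw [hcard, Nat.cast_ne_zero]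
    exact (Nat.choose_pos (by lia)).ne'
  refine sum_mul_eval_eq_zero_of_degree_lt _ _ s (fun j hj => ?_) L hL
  set p : ℚ[X] := (Polynomial.C (-2) * X + Polynomial.C ((N + 1 : ℕ) : ℚ)) ^ j with hp
  have hlin : (Polynomial.C (-2) * X + Polynomial.C ((N + 1 : ℕ) : ℚ)).degree = 1 :=
    degree_linear (by norm_num)
  have hpdeg : p.degree = j := by rw [hp, degree_pow, hlin, nsmul_one]
  have hppar : ∀ t : ℚ, p.eval (((N + 1 : ℕ) : ℚ) - t) = (-1) ^ j * p.eval t := by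
    intro t
    simp only [hp, eval_pow, eval_add, eval_mul, eval_C, eval_X, ← mul_pow]
    congr 1
    ring
  refine ⟨p, hpdeg, ?_⟩
  by_cases hpar : Even (s + j)
  · have hj2 : j + 2 ≤ s := by
      obtain ⟨a, ha⟩ := hpar
      lia
    set P : ℚ[X] := X * (Polynomial.C ((N + 1 : ℕ) : ℚ) - X) * p with hP
    have hPdeg : P.natDegree ≤ s := by
      have h1 : (Polynomial.C ((N + 1 : ℕ) : ℚ) - X).natDegree = 1 := by
        rw [← neg_sub, natDegree_neg, natDegree_X_sub_C]
      have h2 := natDegree_mul_le (p := X * (Polynomial.C ((N + 1 : ℕ) : ℚ) - X)) (q := p)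
      have h3 := natDegree_mul_le (p := (X : ℚ[X])) (q := Polynomial.C ((N + 1 : ℕ) : ℚ) - X)
      rw [natDegree_X, h1] at h3
      rw [natDegree_eq_of_degree_eq_some hpdeg] at h2
      lia
    have hsign : (-1 : ℚ) ^ j = (-1) ^ s := by
      obtain ⟨a, ha⟩ := hpar
      rw [show s = j + 2 * (a - j) by lia, pow_add, pow_mul]
      simp
    have hPpar : ∀ t : ℚ, P.eval (((N + 1 : ℕ) : ℚ) - t) = (-1) ^ s * P.eval t := by
      intro t
      simp only [hP, eval_mul, eval_sub, eval_C, eval_X, hppar, hsign]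
      ring
    have key : ∑ k ∈ range (N + 1 + 1), ((N + 1).choose k * (N + 1).choose (N + 1 - k) : ℚ) *
        (P.eval (k : ℚ) * A.eval (k : ℚ)) = 0 := by
      have h := Finset.sum_eq_zero (s := (univ : Finset α).powersetCard (N + 1)) fun z hz =>
        (sum_eval_johnsonDist_mul_of_tight hα (Nat.succ_pos N) hs hA hApar hPdeg hPpar C hC hcard
          hA0 hAC z (Finset.mem_powersetCard.1 hz).2).trans
          (by simp [hP] : A.eval 0 * P.eval 0 = 0)
      rw [Finset.sum_comm, Finset.sum_congr rfl fun x hx => (Finset.sum_congr rfl fun z _ => by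
        rw [Finset.inter_comm z x]).trans (sum_powersetCard_comp_card_inter hα x (hC x hx)
          fun d => P.eval (d : ℚ) * A.eval (d : ℚ)), Finset.sum_const, nsmul_eq_mul] at h
      exact (mul_eq_zero.1 h).resolve_left hC0
    have hN : ((N : ℚ) + 1) ^ 2 ≠ 0 := by positivity
    refine (mul_eq_zero.1 ?_).resolve_left hN
    rw [← key, Finset.mul_sum]
    refine Finset.sum_congr rfl fun k hk => ?_
    have hk' : k ≤ N + 1 := Nat.lt_succ_iff.1 (Finset.mem_range.1 hk)
    have h1 : (N.choose k : ℚ) * (N + 1) = (N + 1).choose k * ((N + 1 : ℕ) - k) := by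
      rw [← Nat.cast_sub hk']
      exact_mod_cast Nat.choose_mul_succ_eq N k
    have h2 : (N.choose (N + 1 - k) : ℚ) * (N + 1) = (N + 1).choose (N + 1 - k) * k := by
      have := Nat.choose_mul_succ_eq N (N + 1 - k)
      rw [Nat.sub_sub_self hk'] at this
      exact_mod_cast this
    simp only [hP, eval_mul, eval_sub, eval_C, eval_X]
    linear_combination (A.eval (k : ℚ) * p.eval (k : ℚ) * (N.choose (N + 1 - k) * (N + 1))) * h1 +
      (A.eval (k : ℚ) * p.eval (k : ℚ) * ((N + 1).choose k * ((N + 1 : ℕ) - k))) * h2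
  · have hsign : (-1 : ℚ) ^ s * (-1) ^ j = -1 := by
      rw [← pow_add, (Nat.not_even_iff_odd.1 hpar).neg_one_pow]
    have hflip := Finset.sum_flip (n := N + 1) fun k =>
      (N.choose k * N.choose (N + 1 - k) : ℚ) * A.eval (k : ℚ) * p.eval (k : ℚ)
    have hneg : ∑ k ∈ range (N + 1 + 1), (N.choose (N + 1 - k) *
        N.choose (N + 1 - (N + 1 - k)) : ℚ) * A.eval ((N + 1 - k : ℕ) : ℚ) *
          p.eval ((N + 1 - k : ℕ) : ℚ) =
        -∑ k ∈ range (N + 1 + 1), (N.choose k * N.choose (N + 1 - k) : ℚ) * A.eval (k : ℚ) *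
          p.eval (k : ℚ) := by
      rw [← Finset.sum_neg_distrib]
      refine Finset.sum_congr rfl fun k hk => ?_
      have hk' : k ≤ N + 1 := Nat.lt_succ_iff.1 (Finset.mem_range.1 hk)
      rw [Nat.sub_sub_self hk', Nat.cast_sub hk', hApar, hppar]
      linear_combination (N.choose (N + 1 - k) * N.choose k * A.eval (k : ℚ) * p.eval (k : ℚ)) *
        hsign
    rw [hneg] at hflip
    exact self_eq_neg.1 hflip.symm

theorem degree_Phi_sub_lt (ρ s : ℕ) (hs : 0 < s) {A : ℚ[X]} (hA : A.Monic)
    (hAdeg : A.natDegree = s) :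
    (Phi (ρ + 1) s - Polynomial.C ((-1) ^ s) * A).degree < (s : WithBot ℕ) := by
  have h0 : pcoef (ρ + 1) s 0 = 1 := by simp [pcoef]
  rw [Phi, Finset.sum_range_succ', h0, Nat.sub_zero, mul_one, add_sub_assoc, ← mul_sub]
  refine (degree_add_le _ _).trans_lt (max_lt ?_ ?_)
  · refine (degree_sum_le _ _).trans_lt ((Finset.sup_lt_iff (WithBot.bot_lt_coe s)).2 fun i hi => ?_)
    rw [← smul_eq_C_mul]
    refine (degree_smul_le _ _).trans_lt ?_
    rw [degree_eq_natDegree (monic_descPochhammer ℚ _).ne_zero, descPochhammer_natDegree]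
    rw [Finset.mem_range] at hi
    exact WithBot.coe_lt_coe.2 (show s - (i + 1) < s by lia)
  · rw [← smul_eq_C_mul]
    refine (degree_smul_le _ _).trans_lt ?_
    have hd : (descPochhammer ℚ s).degree = s := by
      rw [degree_eq_natDegree (monic_descPochhammer ℚ s).ne_zero, descPochhammer_natDegree]
    rw [← hd]
    refine degree_sub_lt_left ?_ (monic_descPochhammer ℚ s).ne_zero ?_
    · rw [hd, degree_eq_natDegree hA.ne_zero, hAdeg]
    · rw [(monic_descPochhammer ℚ s).leadingCoeff, hA.leadingCoeff]

theorem Phi_eq_of_orthogonal (ρ s : ℕ) (hs : 0 < s) {A : ℚ[X]} (hA : A.Monic)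
    (hAdeg : A.natDegree = s)
    (horth : ∀ L : ℚ[X], L.degree < s → ∑ k ∈ range (ρ + s + 2),
      ((ρ + s).choose k * (ρ + s).choose (ρ + s + 1 - k) : ℚ) * A.eval (k : ℚ) *
        L.eval (k : ℚ) = 0) :
    Phi (ρ + 1) s = Polynomial.C ((-1) ^ s) * A := by
  set D := Phi (ρ + 1) s - Polynomial.C ((-1) ^ s) * A with hD
  have hDdeg : D.degree < s := degree_Phi_sub_lt ρ s hs hA hAdeg
  have hsq : ∑ k ∈ range (ρ + s + 2),
      ((ρ + s).choose k * (ρ + s).choose (ρ + s + 1 - k) : ℚ) * D.eval (k : ℚ) ^ 2 = 0 := by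
    have h1 := sum_choose_mul_Phi_mul_eval ρ s D hDdeg
    have h2 := congrArg ((-1 : ℚ) ^ s * ·) (horth D hDdeg)
    simp only [Finset.mul_sum, mul_zero] at h2
    rw [← sub_zero (0 : ℚ)]
    nth_rewrite 1 [← h1]
    rw [← h2, ← Finset.sum_sub_distrib]
    refine Finset.sum_congr rfl fun k _ => ?_
    rw [pow_two]
    nth_rewrite 1 [hD]
    simp only [eval_sub, eval_mul, eval_C]
    ring
  rw [Finset.sum_eq_zero_iff_of_nonneg fun k _ => by positivity] at hsq
  rw [← sub_eq_zero, ← hD]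
  refine eq_zero_of_degree_lt_of_eval_finset_eq_zero
    ((Finset.Icc 1 (ρ + s)).image fun k : ℕ => (k : ℚ)) ?_ ?_
  · rw [Finset.card_image_of_injective _ Nat.cast_injective, Nat.card_Icc]
    exact hDdeg.trans_le (by exact_mod_cast (show s ≤ ρ + s + 1 - 1 by lia))
  · intro t ht
    obtain ⟨k, hk, rfl⟩ := Finset.mem_image.1 ht
    rw [Finset.mem_Icc] at hk
    have h := hsq k (Finset.mem_range.2 (by lia))
    have hw : ((ρ + s).choose k * (ρ + s).choose (ρ + s + 1 - k) : ℚ) ≠ 0 := by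
      exact_mod_cast (Nat.mul_pos (Nat.choose_pos hk.2) (Nat.choose_pos (by lia))).ne'
    exact pow_eq_zero_iff two_ne_zero |>.1 ((mul_eq_zero.1 h).resolve_left hw)

theorem johnsonDistSet_subset_Icc {n : ℕ} {C : Finset (Finset (Fin (2 * n)))}
    (hcard : ∀ x ∈ C, x.card = n)
    (hsym : ∀ a ∈ johnsonDistSet n C, n - a ∈ johnsonDistSet n C) :
    johnsonDistSet n C ⊆ Finset.Icc 1 (n - 1) := by
  have hpos : ∀ a ∈ johnsonDistSet n C, 0 < a := by
    intro a ha
    simp only [johnsonDistSet, Finset.mem_image, Finset.mem_filter, Finset.mem_product] at ha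
    obtain ⟨⟨x, y⟩, ⟨⟨hx, hy⟩, hne⟩, rfl⟩ := ha
    refine Nat.sub_pos_of_lt ?_
    refine (Finset.card_lt_card
      (Finset.inter_subset_left.ssubset_of_ne fun h => hne ?_)).trans_eq (hcard x hx)
    exact Finset.eq_of_subset_of_card_le (Finset.inter_eq_left.1 h)
      (by rw [hcard x hx, hcard y hy])
  intro a ha
  have h1 := hpos a ha
  have h2 := hpos _ (hsym a ha)
  rw [Finset.mem_Icc]
  lia

theorem Phi_eq_prod_of_tight (r s : ℕ) (hr : 0 < r) (hs : 0 < s)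
    (C : Finset (Finset (Fin (2 * (r + s)))))
    (hcard : ∀ x ∈ C, x.card = r + s)
    (hdeg : (johnsonDistSet (r + s) C).card = s)
    (hsym : ∀ a ∈ johnsonDistSet (r + s) C, (r + s) - a ∈ johnsonDistSet (r + s) C)
    (htight : C.card = (2 * (r + s) - 1).choose s) :
    Phi r s = Polynomial.C ((-1) ^ s) *
      ∏ a ∈ johnsonDistSet (r + s) C, (X - Polynomial.C (a : ℚ)) := by
  have hIcc := johnsonDistSet_subset_Icc hcard hsym
  set S := johnsonDistSet (r + s) C with hS
  have hle : ∀ a ∈ S, 1 ≤ a ∧ a ≤ r + s := fun a ha => by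
    have := Finset.mem_Icc.1 (hIcc ha)
    lia
  set A : ℚ[X] := ∏ a ∈ S, (X - Polynomial.C (a : ℚ)) with hA
  have hAeval : ∀ t : ℚ, A.eval t = ∏ a ∈ S, (t - a) := fun t => by
    simp [hA, eval_prod]
  have hAdeg : A.natDegree = s := by
    rw [hA, natDegree_finsetProd_X_sub_C_eq_card, hdeg]
  have hApar : ∀ t : ℚ, A.eval (((r + s : ℕ) : ℚ) - t) = (-1) ^ s * A.eval t := by
    intro t
    have hsign : (-1 : ℚ) ^ s = ∏ a ∈ S, (-1) := by rw [Finset.prod_const, hdeg]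
    rw [hAeval, hAeval, hsign, ← Finset.prod_mul_distrib]
    refine Finset.prod_nbij' (fun a => r + s - a) (fun a => r + s - a) hsym hsym
      (fun a ha => Nat.sub_sub_self (hle a ha).2) (fun a ha => Nat.sub_sub_self (hle a ha).2)
      fun a ha => ?_
    rw [Nat.cast_sub (hle a ha).2]
    ring
  have hA0 : A.eval 0 ≠ 0 := by
    rw [hAeval, Finset.prod_ne_zero_iff]
    intro a ha
    have := (hle a ha).1
    rw [zero_sub, neg_ne_zero, Nat.cast_ne_zero]
    lia
  have hAC : ∀ x ∈ C, ∀ y ∈ C, x ≠ y → A.eval ((r + s - (x ∩ y).card : ℕ) : ℚ) = 0 := by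
    intro x hx y hy hxy
    rw [hAeval]
    refine Finset.prod_eq_zero (i := r + s - (x ∩ y).card) ?_ (sub_self _)
    rw [hS, johnsonDistSet]
    exact Finset.mem_image.2 ⟨(x, y), by simp [hx, hy, hxy], rfl⟩
  obtain ⟨ρ, rfl⟩ := Nat.exists_eq_add_of_le' hr
  refine Phi_eq_of_orthogonal ρ s hs (monic_prod_of_monic _ _ fun a _ => monic_X_sub_C _) hAdeg fun L hL => ?_
  have hn : ρ + 1 + s = ρ + s + 1 := by ring
  rw [hn] at hApar
  exact sum_choose_mul_eval_mul_eval_of_tight (by rw [Fintype.card_fin, hn]) (by lia) hAdeg.le hApar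
    C (by rwa [← hn]) (by rwa [← hn]) hA0 (by rwa [← hn]) L hL

/-- If a tight symmetric-distance Johnson code of degree `s` exists in
`J(2n, n)` with `n = r + s`, then `Φ_s` has `s` pairwise distinct integer zeros, and every
zero of `Φ_s` lies in `[1, r + s − 1]`. -/
theorem stmt_2 (r s : ℕ) (hr : 0 < r) (hs : 0 < s)
    (C : Finset (Finset (Fin (2 * (r + s)))))
    (hcard : ∀ x ∈ C, x.card = r + s)
    (hdeg : (johnsonDistSet (r + s) C).card = s)
    (hsym : ∀ a ∈ johnsonDistSet (r + s) C, (r + s) - a ∈ johnsonDistSet (r + s) C)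
    (htight : C.card = (2 * (r + s) - 1).choose s) :
    (∃ T : Finset ℤ, T.card = s ∧ ∀ t ∈ T, (Phi r s).eval (t : ℚ) = 0) ∧
      ∀ z : ℚ, (Phi r s).eval z = 0 → 1 ≤ z ∧ z ≤ (r : ℚ) + s - 1 := by
  have hPhi := Phi_eq_prod_of_tight r s hr hs C hcard hdeg hsym htight
  have hIcc := johnsonDistSet_subset_Icc hcard hsym
  have heval : ∀ z : ℚ, (Phi r s).eval z =
      (-1) ^ s * ∏ a ∈ johnsonDistSet (r + s) C, (z - a) := fun z => by
    simp [hPhi, eval_prod]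
  refine ⟨⟨(johnsonDistSet (r + s) C).image ((↑) : ℕ → ℤ), ?_, ?_⟩, ?_⟩
  · rw [Finset.card_image_of_injective _ Nat.cast_injective, hdeg]
  · intro t ht
    obtain ⟨a, ha, rfl⟩ := Finset.mem_image.1 ht
    rw [heval, Finset.prod_eq_zero ha (by simp), mul_zero]
  · intro z hz
    rw [heval, mul_eq_zero, Finset.prod_eq_zero_iff] at hz
    obtain ⟨a, ha, hza⟩ := hz.resolve_left (pow_ne_zero _ (by norm_num))
    have h := Finset.mem_Icc.1 (hIcc ha)
    rw [sub_eq_zero.1 hza, le_sub_iff_add_le]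
    exact ⟨by exact_mod_cast h.1, by exact_mod_cast (show a + 1 ≤ r + s by lia)⟩
end

section
/- Let r, s be positive integers. If every complex zero of the polynomial Φ_s is an integer, then s = 1, or r = 1, or s ≥ 5000·r·(14.5 + ln r)². -/
open Finset Polynomial

/-- For `q` odd, at most `(k - 1) / q + 1` of the terms `m, m + 2, …, m + 2 (k - 1)` are
divisible by `q`. -/
lemma card_filter_dvd_add_two_mul_le {q k m : ℕ} (hq : Odd q) :
    #{j ∈ range k | q ∣ m + 2 * j} ≤ (k - 1) / q + 1 := by
  have hq0 : 0 < q := hq.pos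
  have hinj : Set.InjOn (fun j => j / q) ({j ∈ range k | q ∣ m + 2 * j} : Finset ℕ) := by
    intro a ha b hb hab
    simp only [coe_filter, mem_range, Set.mem_ofPred_eq] at ha hb hab
    have h1 : (m + 2 * a) ≡ (m + 2 * b) [MOD q] :=
      ((Nat.modEq_zero_iff_dvd.2 ha.2).trans (Nat.modEq_zero_iff_dvd.2 hb.2).symm)
    have h2 : 2 * a ≡ 2 * b [MOD q] := Nat.ModEq.add_left_cancel' m h1
    have h3 : a ≡ b [MOD q] :=
      Nat.ModEq.cancel_left_of_coprime (by simpa using hq.coprime_two_right) h2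
    rw [← Nat.div_add_mod a q, ← Nat.div_add_mod b q, hab, h3]
  rw [← card_image_of_injOn hinj]
  calc _ ≤ #(range ((k - 1) / q + 1)) := by
        refine card_le_card ?_
        intro x hx
        simp only [mem_image, mem_filter, mem_range] at hx ⊢
        obtain ⟨j, ⟨hj, -⟩, rfl⟩ := hx
        exact Nat.lt_succ_of_le (Nat.div_le_div_right (by omega))
    _ = _ := card_range _

lemma factorization_prod_odd_le {p k m : ℕ} (hp : p.Prime) (hp2 : p ≠ 2) (hk : 0 < k)
    (hm : 0 < m) :
    (∏ j ∈ range k, (m + 2 * j)).factorization p ≤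
      (k - 1).factorial.factorization p + Nat.log p (m + 2 * (k - 1)) := by
  set L := Nat.log p (m + 2 * (k - 1)) with hL
  have hfac : ∀ j ∈ range k, (m + 2 * j).factorization p =
      #{i ∈ Ico 1 (L + 1) | p ^ i ∣ m + 2 * j} := by
    intro j hj
    rw [mem_range] at hj
    refine Nat.factorization_eq_card_pow_dvd_of_lt hp (by omega) ?_
    refine Nat.lt_pow_of_log_lt hp.one_lt (Nat.lt_succ_of_le (Nat.log_mono_right (by omega)))
  rw [Nat.factorization_prod (fun j _ => by omega), Finsupp.finsetSum_apply, sum_congr rfl hfac]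
  simp only [card_filter]
  rw [sum_comm]
  have hb : Nat.log p (k - 1) < L + 1 :=
    Nat.lt_succ_of_le (Nat.log_mono_right (by omega))
  rw [Nat.factorization_factorial hp hb]
  calc _ ≤ ∑ i ∈ Ico 1 (L + 1), ((k - 1) / p ^ i + 1) := by
        refine sum_le_sum fun i _ => ?_
        rw [← card_filter]
        exact card_filter_dvd_add_two_mul_le ((hp.odd_of_ne_two hp2).pow)
    _ = _ := by simp [sum_add_distrib]

lemma prod_odd_mul_le {k m : ℕ} (hk : 0 < k) (hm : Odd m) :
    (∏ j ∈ range k, (m + 2 * j)) * 2 ^ (k - 1).factorial.factorization 2 ≤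
      (k - 1).factorial *
        ∏ p ∈ (∏ j ∈ range k, (m + 2 * j)).primeFactors,
          p ^ Nat.log p (m + 2 * (k - 1)) := by
  set P := ∏ j ∈ range k, (m + 2 * j) with hP
  set N := m + 2 * (k - 1)
  have hm0 : 0 < m := hm.pos
  have hP0 : P ≠ 0 := prod_ne_zero_iff.2 fun j _ => by omega
  have hPodd : ¬ 2 ∣ P := by
    rw [hP, Nat.prime_two.prime.dvd_finsetProd_iff]
    rintro ⟨j, -, hj⟩
    obtain ⟨t, rfl⟩ := hm
    omega
  have hE0 : ∏ p ∈ P.primeFactors, p ^ Nat.log p N ≠ 0 :=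
    prod_ne_zero_iff.2 fun p hp => pow_ne_zero _ (Nat.prime_of_mem_primeFactors hp).ne_zero
  have hf0 : (k - 1).factorial ≠ 0 := Nat.factorial_ne_zero _
  refine Nat.le_of_dvd (Nat.pos_of_ne_zero (mul_ne_zero hf0 hE0)) ?_
  rw [← Nat.factorization_prime_le_iff_dvd (by positivity) (mul_ne_zero hf0 hE0)]
  intro p hp
  rw [Nat.factorization_mul hP0 (by positivity), Nat.factorization_mul hf0 hE0]
  simp only [Finsupp.add_apply, Nat.Prime.factorization_pow Nat.prime_two]
  by_cases hp2 : p = 2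
  · subst hp2
    simp [Nat.factorization_eq_zero_of_not_dvd hPodd]
  · simp only [Finsupp.single_apply, Ne.symm hp2, if_false, add_zero]
    by_cases hpP : p ∣ P
    · have h1 : P.factorization p ≤ (k - 1).factorial.factorization p + Nat.log p N :=
        factorization_prod_odd_le hp hp2 hk hm0
      have h2 : Nat.log p N ≤ (∏ p ∈ P.primeFactors, p ^ Nat.log p N).factorization p := by
        rw [← hp.pow_dvd_iff_le_factorization hE0]
        exact dvd_prod_of_mem (fun p => p ^ Nat.log p N)
          (Nat.mem_primeFactors.2 ⟨hp, hpP, hP0⟩)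
      omega
    · simp [Nat.factorization_eq_zero_of_not_dvd hpP]

lemma two_pow_le_succ_mul_two_pow_factorization (n : ℕ) :
    2 ^ n ≤ (n + 1) * 2 ^ n.factorial.factorization 2 := by
  have key : ∀ t, (2 * t).factorial.factorization 2 = t.factorial.factorization 2 + t := by
    intro t
    have := padicValNat_factorial_mul (p := 2) t
    rwa [← Nat.factorization_def _ Nat.prime_two, ← Nat.factorization_def _ Nat.prime_two] at this
  have heven : ∀ t, 2 ^ t ≤ (t + 1) * 2 ^ t.factorial.factorization 2 →
      2 ^ (2 * t) ≤ (t + 1) * 2 ^ (2 * t).factorial.factorization 2 := by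
    intro t ht
    rw [key, two_mul, pow_add, pow_add]
    calc 2 ^ t * 2 ^ t ≤ ((t + 1) * 2 ^ t.factorial.factorization 2) * 2 ^ t :=
          Nat.mul_le_mul_right _ ht
      _ = _ := by ring
  induction n using Nat.strong_induction_on with
  | _ n ih =>
    rcases Nat.even_or_odd' n with ⟨t, rfl | rfl⟩
    · rcases Nat.eq_zero_or_pos t with rfl | ht
      · simp
      · refine (heven t (ih t (by omega))).trans (Nat.mul_le_mul_right _ (by omega))
    · have h1 := heven t (ih t (by omega))
      have h2 : (2 * t).factorial.factorization 2 ≤ (2 * t + 1).factorial.factorization 2 := by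
        have hd : (2 * t).factorial ∣ (2 * t + 1).factorial :=
          Nat.factorial_dvd_factorial (by omega)
        exact (Nat.factorization_le_iff_dvd (Nat.factorial_ne_zero _)
          (Nat.factorial_ne_zero _)).2 hd 2
      calc 2 ^ (2 * t + 1) = 2 * 2 ^ (2 * t) := by ring
        _ ≤ 2 * ((t + 1) * 2 ^ (2 * t).factorial.factorization 2) := Nat.mul_le_mul_left _ h1
        _ ≤ 2 * ((t + 1) * 2 ^ (2 * t + 1).factorial.factorization 2) := by gcongr; norm_num
        _ = _ := by ring

/-- Scaling a descending product of `k` numbers of step two. -/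
lemma prod_sub_mul_pow_le {k N₀ N : ℕ} (h : N₀ ≤ N) :
    (∏ j ∈ range k, (N₀ - 2 * j)) * N ^ k ≤ (∏ j ∈ range k, (N - 2 * j)) * N₀ ^ k := by
  have hpow : ∀ x : ℕ, x ^ k = ∏ _j ∈ range k, x := fun x => by simp
  rw [hpow N, hpow N₀, ← prod_mul_distrib, ← prod_mul_distrib]
  refine prod_le_prod' fun j _ => ?_
  rcases le_total N₀ (2 * j) with h1 | h1
  · simp [Nat.sub_eq_zero_of_le h1]
  · obtain ⟨a, rfl⟩ := Nat.exists_eq_add_of_le h1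
    obtain ⟨b, rfl⟩ := Nat.exists_eq_add_of_le h
    have : 2 * j + a + b - 2 * j = a + b := by omega
    rw [this, Nat.add_sub_cancel_left]
    nlinarith [Nat.zero_le (2 * j * b)]

lemma prod_add_eq_prod_sub {k m : ℕ} (hk : 0 < k) :
    ∏ j ∈ range k, (m + 2 * j) = ∏ j ∈ range k, (m + 2 * (k - 1) - 2 * j) := by
  rw [← prod_range_reflect]
  refine prod_congr rfl fun j hj => ?_
  rw [mem_range] at hj
  omega

lemma prod_four_mul_sub (k : ℕ) :
    ∏ j ∈ range k, (4 * k - 2 * j) = 2 ^ k * (k.factorial * k.centralBinom) := by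
  have h1 : ∏ j ∈ range k, (4 * k - 2 * j) = ∏ j ∈ range k, 2 * (2 * k - j) :=
    prod_congr rfl fun j _ => by omega
  rw [h1, prod_mul_distrib, prod_const, card_range, ← Nat.descFactorial_eq_prod_range,
    Nat.descFactorial_eq_factorial_mul_choose, Nat.centralBinom]

lemma four_mul_pow_le {k m : ℕ} (hk : 0 < k) (hm : Odd m) (hkm : 2 * k + 1 < m) :
    (4 * (m + 2 * (k - 1))) ^ k ≤ 4 * k ^ (k + 1) *
        ∏ p ∈ (∏ j ∈ range k, (m + 2 * j)).primeFactors,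
          p ^ Nat.log p (m + 2 * (k - 1)) := by
  have h1 := prod_odd_mul_le hk hm
  set E := ∏ p ∈ (∏ j ∈ range k, (m + 2 * j)).primeFactors,
          p ^ Nat.log p (m + 2 * (k - 1))
  rw [prod_add_eq_prod_sub hk] at h1
  set N := m + 2 * (k - 1)
  have h2 := prod_sub_mul_pow_le (k := k) (show 4 * k ≤ N by omega)
  rw [prod_four_mul_sub] at h2
  have h3 := Nat.four_pow_le_two_mul_self_mul_centralBinom k hk
  have h4 := two_pow_le_succ_mul_two_pow_factorization (k - 1)
  rw [Nat.sub_add_cancel hk] at h4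
  set Q := ∏ j ∈ range k, (N - 2 * j)
  set v := 2 ^ (k - 1).factorial.factorization 2
  set f := (k - 1).factorial with hf
  have hkf : k.factorial = k * f := (Nat.mul_factorial_pred hk.ne').symm
  have hf0 : 0 < f := Nat.factorial_pos _
  rw [hkf] at h2
  have h5 : 2 ^ k ≤ 2 * (k * v) := by
    calc 2 ^ k = 2 * 2 ^ (k - 1) := by rw [← pow_succ', Nat.sub_add_cancel hk]
      _ ≤ _ := Nat.mul_le_mul_left _ h4
  have h6 : f * (2 ^ k * (4 ^ k * (2 ^ k * N ^ k))) ≤ f * ((4 * k ^ (k + 1) * E) * 4 ^ k) := by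
    calc f * (2 ^ k * (4 ^ k * (2 ^ k * N ^ k)))
        ≤ f * (2 ^ k * ((2 * k * k.centralBinom) * ((2 * (k * v)) * N ^ k))) := by gcongr
      _ = 4 * k * v * ((2 ^ k * (k * f * k.centralBinom)) * N ^ k) := by ring
      _ ≤ 4 * k * v * (Q * (4 * k) ^ k) := by gcongr
      _ = 4 * k * (4 * k) ^ k * (Q * v) := by ring
      _ ≤ 4 * k * (4 * k) ^ k * (f * E) := by gcongr
      _ = _ := by rw [mul_pow]; ring
  have h7 := Nat.le_of_mul_le_mul_left h6 hf0
  refine Nat.le_of_mul_le_mul_right (c := 4 ^ k) ?_ (by positivity)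
  refine le_trans (le_of_eq ?_) h7
  rw [mul_pow]
  have : (4 : ℕ) ^ k = 2 ^ k * 2 ^ k := by rw [← mul_pow]; norm_num
  nth_rewrite 1 [this]
  ring

/-- All prime factors of `m, m + 2, …, m + 2 (k - 1)` are at most `2 k + 1`. -/
def OddSmooth (k m : ℕ) : Prop :=
  ∀ j < k, ∀ p, p.Prime → p ∣ m + 2 * j → p ≤ 2 * k + 1

/-- The odd primes up to `47`. -/
def smallOddPrimes : List ℕ := [3, 5, 7, 11, 13, 17, 19, 23, 29, 31, 37, 41, 43, 47]

/-- A test satisfied by all odd primes. -/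
def oddPrimeTest (n : ℕ) : Bool :=
  smallOddPrimes.contains n || Nat.gcd n 307444891294245705 == 1

/-- The number of odd `n` with `3 ≤ n ≤ 2 k + 1` passing `oddPrimeTest`. -/
def oddPrimeCount : ℕ → ℕ
  | 0 => 0
  | k + 1 => oddPrimeCount k + if oddPrimeTest (2 * k + 3) then 1 else 0

lemma oddPrimeTest_of_prime {p : ℕ} (hp : p.Prime) : oddPrimeTest p = true := by
  unfold oddPrimeTest
  rw [Bool.or_eq_true]
  by_cases h : p ∣ 307444891294245705
  · left
    rw [show 307444891294245705 = smallOddPrimes.prod by decide] at h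
    rw [hp.prime.dvd_prod_iff] at h
    obtain ⟨a, ha, hpa⟩ := h
    have hap : ∀ a ∈ smallOddPrimes, a.Prime := by
      simp only [smallOddPrimes, List.forall_mem_cons]
      norm_num
    rw [(Nat.prime_dvd_prime_iff_eq hp (hap a ha)).1 hpa]
    simpa using ha
  · right
    simpa using (Nat.Prime.coprime_iff_not_dvd hp).2 h

lemma oddPrimeCount_eq (k : ℕ) :
    oddPrimeCount k = #{j ∈ range k | oddPrimeTest (2 * j + 3) = true} := by
  induction k with
  | zero => rfl
  | succ k ih =>
    rw [range_add_one, filter_insert, oddPrimeCount, ih]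
    split_ifs <;> simp

lemma oddPrimeCount_le (k : ℕ) : oddPrimeCount k ≤ k := by
  rw [oddPrimeCount_eq]
  exact (card_filter_le _ _).trans (card_range k).le

lemma OddSmooth.of_mem_primeFactors {k m p : ℕ} (h : OddSmooth k m) (hm : Odd m)
    (hp : p ∈ (∏ j ∈ range k, (m + 2 * j)).primeFactors) :
    p.Prime ∧ p ≠ 2 ∧ p ≤ 2 * k + 1 ∧ ∃ j < k, p ∣ m + 2 * j := by
  have hpp := Nat.prime_of_mem_primeFactors hp
  have hd := Nat.dvd_of_mem_primeFactors hp
  rw [hpp.prime.dvd_finsetProd_iff] at hd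
  obtain ⟨j, hj, hpj⟩ := hd
  rw [mem_range] at hj
  refine ⟨hpp, ?_, h j hj p hpp hpj, j, hj, hpj⟩
  rintro rfl
  obtain ⟨t, rfl⟩ := hm
  omega

lemma OddSmooth.card_primeFactors_le {k m : ℕ} (h : OddSmooth k m) (hm : Odd m) :
    #(∏ j ∈ range k, (m + 2 * j)).primeFactors ≤ oddPrimeCount k := by
  rw [oddPrimeCount_eq]
  refine (card_le_card (t := image (fun j => 2 * j + 3)
    {j ∈ range k | oddPrimeTest (2 * j + 3) = true}) ?_).trans card_image_le
  intro p hp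
  obtain ⟨hpp, hp2, hpk, -⟩ := h.of_mem_primeFactors hm hp
  obtain ⟨t, rfl⟩ := hpp.odd_of_ne_two hp2
  have := hpp.two_le
  simp only [mem_image, mem_filter, mem_range]
  refine ⟨t - 1, ⟨by omega, ?_⟩, by omega⟩
  rw [show 2 * (t - 1) + 3 = 2 * t + 1 by omega]
  exact oddPrimeTest_of_prime hpp

lemma prod_primeFactors_pow_log_le (P : ℕ) {N : ℕ} (hN : N ≠ 0) :
    ∏ p ∈ P.primeFactors, p ^ Nat.log p N ≤ N ^ #P.primeFactors :=
  prod_le_pow_card _ _ _ fun p _ => Nat.pow_log_le_self p hN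

lemma OddSmooth.prod_pow_log_le {k m : ℕ} (h : OddSmooth k m) (hm : Odd m) :
    ∏ p ∈ (∏ j ∈ range k, (m + 2 * j)).primeFactors, p ^ Nat.log p (m + 2 * (k - 1)) ≤
      (m + 2 * (k - 1)) ^ oddPrimeCount k := by
  have := hm.pos
  exact (prod_primeFactors_pow_log_le _ (by omega)).trans
    (Nat.pow_le_pow_right (by omega) (h.card_primeFactors_le hm))

/-- The numerical inequality excluding `OddSmooth k m` for every odd `m` above `2 k + 1`. -/
def powTest (k c : ℕ) : Bool :=
  Nat.blt (4 * k ^ (k + 1) * (4 * k + 1) ^ c) ((4 * (4 * k + 1)) ^ k)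

lemma not_oddSmooth_of_powTest {k m : ℕ} (hk : 0 < k) (hm : Odd m) (hkm : 2 * k + 1 < m)
    (ht : powTest k (oddPrimeCount k) = true) : ¬ OddSmooth k m := by
  intro h
  have h1 := (four_mul_pow_le hk hm hkm).trans
    (Nat.mul_le_mul_left _ (h.prod_pow_log_le hm))
  simp only [powTest, Nat.blt_eq] at ht
  have hc := oddPrimeCount_le k
  set c := oddPrimeCount k
  have hN : 4 * k + 1 ≤ m + 2 * (k - 1) := by
    obtain ⟨t, rfl⟩ := hm
    omega
  set N := m + 2 * (k - 1)
  set M := 4 * k + 1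
  have hMN : M ^ k * N ^ c ≤ M ^ c * N ^ k := by
    obtain ⟨d, hd⟩ := Nat.exists_eq_add_of_le hc
    rw [hd]
    calc M ^ (c + d) * N ^ c = M ^ c * N ^ c * M ^ d := by ring
      _ ≤ M ^ c * N ^ c * N ^ d := by gcongr
      _ = _ := by ring
  have h2 : (4 * M) ^ k * N ^ k ≤ (4 * k ^ (k + 1) * M ^ c) * N ^ k := by
    calc (4 * M) ^ k * N ^ k = M ^ k * (4 * N) ^ k := by rw [mul_pow, mul_pow]; ring
      _ ≤ M ^ k * (4 * k ^ (k + 1) * N ^ c) := by gcongr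
      _ = 4 * k ^ (k + 1) * (M ^ k * N ^ c) := by ring
      _ ≤ 4 * k ^ (k + 1) * (M ^ c * N ^ k) := by gcongr
      _ = _ := by ring
  have hNpos : 0 < N ^ k := by have := hm.pos; positivity
  exact absurd (Nat.le_of_mul_le_mul_right h2 hNpos) (not_le.2 ht)

/-- Run `powTest` on `f` consecutive values starting at `k`, updating the count of odd primes. -/
def powTestRange : ℕ → ℕ → ℕ → Bool
  | 0, _, _ => true
  | f + 1, k, c =>
    powTest k c && powTestRange f (k + 1) (c + if oddPrimeTest (2 * k + 3) then 1 else 0)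

lemma powTest_of_powTestRange {f k : ℕ} (h : powTestRange f k (oddPrimeCount k) = true) {i : ℕ}
    (hi : i < f) : powTest (k + i) (oddPrimeCount (k + i)) = true := by
  induction f generalizing k i with
  | zero => omega
  | succ f ih =>
    rw [powTestRange, Bool.and_eq_true] at h
    rcases i with _ | i
    · exact h.1
    · have := ih (k := k + 1) h.2 (i := i) (by omega)
      rwa [show k + (i + 1) = k + 1 + i by ring]

lemma powTestRange_hundred : powTestRange 1100 100 (oddPrimeCount 100) = true := by
  decide +kernel

/-- A sparse increasing list of primes. -/
def gapPrimes : List ℕ :=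
  [19, 23, 31, 41, 43, 53, 61, 83, 89, 97, 103, 113, 139, 157, 163, 211, 223, 233]

/-- Every odd number in `(2 k + 1, gapBound k]` is followed within `2 k - 2` by a prime larger
than `2 k + 1`. -/
def gapBound (k : ℕ) : ℕ :=
  gapPrimes.foldl (fun b q => if b < q ∧ q ≤ b + 2 * k then q else b) (2 * k + 1)

lemma OddSmooth.gapBound_lt {k m : ℕ} (h : OddSmooth k m) (hm : Odd m) (hkm : 2 * k + 1 < m) :
    Odd (gapBound k) ∧ gapBound k < m := by
  have key : ∀ (l : List ℕ), (∀ q ∈ l, q.Prime) → ∀ b, Odd b → 2 * k + 1 ≤ b → b < m →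
      Odd (l.foldl (fun b q => if b < q ∧ q ≤ b + 2 * k then q else b) b) ∧
      l.foldl (fun b q => if b < q ∧ q ≤ b + 2 * k then q else b) b < m := by
    intro l
    induction l with
    | nil => exact fun _ b hb _ hbm => ⟨hb, hbm⟩
    | cons q l ih =>
      intro hl b hb hkb hbm
      rw [List.foldl_cons]
      have hq : q.Prime := hl q (by simp)
      split_ifs with hbq
      · have hqo : Odd q := hq.odd_of_ne_two (by
          have := hq.two_le
          obtain ⟨t, rfl⟩ := hb
          omega)
        refine ih (fun q hq => hl q (by simp [hq])) q hqo (by omega) ?_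
        by_contra hqm
        obtain ⟨t, ht⟩ := hqo
        obtain ⟨u, hu⟩ := hm
        obtain ⟨w, hw⟩ := hb
        have := h (t - u) (by omega) q hq (by rw [show m + 2 * (t - u) = q by omega])
        omega
      · exact ih (fun q hq => hl q (by simp [hq])) b hb hkb hbm
  refine key gapPrimes ?_ _ (by simp) le_rfl hkm
  simp only [gapPrimes, List.forall_mem_cons]
  norm_num

/-- `stepProd N k = N (N - 2) ⋯ (N - 2 (k - 1))`. -/
def stepProd (N : ℕ) : ℕ → ℕ
  | 0 => 1
  | k + 1 => stepProd N k * (N - 2 * k)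

lemma stepProd_eq (N k : ℕ) : stepProd N k = ∏ j ∈ range k, (N - 2 * j) := by
  induction k with
  | zero => rfl
  | succ k ih => rw [stepProd, ih, prod_range_succ]

/-- The numerical inequality excluding `OddSmooth k m` for every odd `m` above `gapBound k`. -/
def prodTest (k : ℕ) : Bool :=
  Nat.blt (k.factorial * (gapBound k + 2 * k) ^ oddPrimeCount k)
    (stepProd (gapBound k + 2 * k) k * 2 ^ (k - 1))

lemma not_oddSmooth_of_prodTest {k m : ℕ} (hk : 0 < k) (hm : Odd m) (hkm : 2 * k + 1 < m)
    (ht : prodTest k = true) : ¬ OddSmooth k m := by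
  intro h
  have h1 := (prod_odd_mul_le hk hm).trans (Nat.mul_le_mul_left _ (h.prod_pow_log_le hm))
  simp only [prodTest, Nat.blt_eq] at ht
  obtain ⟨hbo, hbm⟩ := h.gapBound_lt hm hkm
  have h4 := two_pow_le_succ_mul_two_pow_factorization (k - 1)
  rw [Nat.sub_add_cancel hk] at h4
  have hc := oddPrimeCount_le k
  rw [prod_add_eq_prod_sub hk] at h1
  rw [stepProd_eq] at ht
  have hN : gapBound k + 2 * k ≤ m + 2 * (k - 1) := by
    obtain ⟨t, rfl⟩ := hm
    obtain ⟨u, hu⟩ := hbo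
    omega
  set c := oddPrimeCount k
  set M := gapBound k + 2 * k
  set N := m + 2 * (k - 1)
  set v := 2 ^ (k - 1).factorial.factorization 2
  have h2 := prod_sub_mul_pow_le (k := k) hN
  have hMN : M ^ k * N ^ c ≤ M ^ c * N ^ k := by
    obtain ⟨d, hd⟩ := Nat.exists_eq_add_of_le hc
    rw [hd]
    calc M ^ (c + d) * N ^ c = M ^ c * N ^ c * M ^ d := by ring
      _ ≤ M ^ c * N ^ c * N ^ d := by gcongr
      _ = _ := by ring
  have h3 : ((∏ j ∈ range k, (M - 2 * j)) * 2 ^ (k - 1)) * N ^ k ≤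
      (k.factorial * M ^ c) * N ^ k := by
    calc ((∏ j ∈ range k, (M - 2 * j)) * 2 ^ (k - 1)) * N ^ k
        ≤ ((∏ j ∈ range k, (M - 2 * j)) * (k * v)) * N ^ k := by gcongr
      _ = k * v * ((∏ j ∈ range k, (M - 2 * j)) * N ^ k) := by ring
      _ ≤ k * v * ((∏ j ∈ range k, (N - 2 * j)) * M ^ k) := by gcongr
      _ = k * M ^ k * ((∏ j ∈ range k, (N - 2 * j)) * v) := by ring
      _ ≤ k * M ^ k * ((k - 1).factorial * N ^ c) := by gcongr
      _ = k * (k - 1).factorial * (M ^ k * N ^ c) := by ring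
      _ ≤ k * (k - 1).factorial * (M ^ c * N ^ k) := by gcongr
      _ = _ := by rw [Nat.mul_factorial_pred hk.ne']; ring
  have hNpos : 0 < N ^ k := by have := hm.pos; positivity
  exact absurd (Nat.le_of_mul_le_mul_right h3 hNpos) (not_le.2 ht)

lemma prodTest_of_lt_hundred : ∀ k < 100, 4 ≤ k → prodTest k = true := by
  decide +kernel

lemma not_oddSmooth_of_lt {k m : ℕ} (hk : 4 ≤ k) (hk' : k < 1200) (hm : Odd m)
    (hkm : 2 * k + 1 < m) : ¬ OddSmooth k m := by
  rcases lt_or_ge k 100 with h | h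
  · exact not_oddSmooth_of_prodTest (by omega) hm hkm (prodTest_of_lt_hundred k h hk)
  · refine not_oddSmooth_of_powTest (by omega) hm hkm ?_
    have := powTest_of_powTestRange powTestRange_hundred (i := k - 100) (by omega)
    rwa [show 100 + (k - 100) = k by omega] at this

lemma card_primesBelow_le_oddPrimeCount_succ (k : ℕ) :
    #(Nat.primesBelow (2 * k + 3)) ≤ oddPrimeCount k + 1 := by
  rw [oddPrimeCount_eq]
  refine (card_le_card (t := insert 2 (image (fun j => 2 * j + 3)
    {j ∈ range k | oddPrimeTest (2 * j + 3) = true})) fun p hp => ?_).trans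
    ((card_insert_le _ _).trans (Nat.succ_le_succ card_image_le))
  rw [Nat.mem_primesBelow] at hp
  rw [mem_insert, mem_image]
  refine hp.2.eq_two_or_odd'.imp_right ?_
  rintro ⟨t, rfl⟩
  have := hp.2.two_le
  have ht : 2 * (t - 1) + 3 = 2 * t + 1 := by omega
  refine ⟨t - 1, mem_filter.2 ⟨mem_range.2 (by omega), ?_⟩, ht⟩
  rw [ht]
  exact oddPrimeTest_of_prime hp.2

lemma card_primesBelow_le_half {k : ℕ} (hk : 1200 ≤ k) :
    2 * #(Nat.primesBelow (2 * k + 2)) ≤ k := by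
  have h := Nat.primeCounting'_add_le (a := 210) (k := 211) (by norm_num) (by norm_num)
    (2 * k + 2 - 211)
  have h' : #(Nat.primesBelow 211) ≤ _ := card_primesBelow_le_oddPrimeCount_succ 104
  rw [Nat.primesBelow_card_eq_primeCounting',
    show oddPrimeCount 104 = 45 by decide +kernel] at h'
  rw [show Nat.totient 210 = 48 by decide +kernel, Nat.add_sub_cancel' (by omega)] at h
  rw [Nat.primesBelow_card_eq_primeCounting']
  omega

lemma card_primesBelow_sqrt_le {N : ℕ} (hN : 36 ≤ N) :
    3 * #(Nat.primesBelow (N.sqrt + 1)) ≤ N.sqrt + 9 := by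
  have h6 : 6 ≤ N.sqrt := Nat.le_sqrt.2 hN
  have h := Nat.primeCounting'_add_le (a := 6) (k := 7) (by norm_num) (by norm_num) (N.sqrt - 6)
  rw [show Nat.primeCounting' 7 = 3 by decide +kernel,
    show Nat.totient 6 = 2 by decide +kernel, show 7 + (N.sqrt - 6) = N.sqrt + 1 by omega] at h
  rw [Nat.primesBelow_card_eq_primeCounting']
  omega

lemma prod_pow_log_le_four_pow {S : Finset ℕ} {B N : ℕ} (hN : N ≠ 0)
    (hS : ∀ p ∈ S, p.Prime ∧ p ≤ B) :
    ∏ p ∈ S, p ^ Nat.log p N ≤ 4 ^ B * N ^ #(Nat.primesBelow (N.sqrt + 1)) := by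
  have h1 : ∀ p ∈ S, p ^ Nat.log p N ≤ p * if p ≤ N.sqrt then N else 1 := by
    intro p hp
    have hpp := (hS p hp).1
    split_ifs with h
    · exact (Nat.pow_log_le_self p hN).trans (Nat.le_mul_of_pos_left _ hpp.pos)
    · rw [mul_one]
      have h2 : N < p ^ 2 := by rw [pow_two]; exact Nat.sqrt_lt.1 (not_le.1 h)
      have h3 := Nat.log_lt_of_lt_pow hN h2
      calc p ^ Nat.log p N ≤ p ^ 1 := Nat.pow_le_pow_right hpp.pos (by omega)
        _ = p := pow_one p
  calc ∏ p ∈ S, p ^ Nat.log p N ≤ ∏ p ∈ S, (p * if p ≤ N.sqrt then N else 1) :=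
        prod_le_prod' h1
    _ = (∏ p ∈ S, p) * ∏ p ∈ S, if p ≤ N.sqrt then N else 1 := prod_mul_distrib
    _ ≤ 4 ^ B * N ^ #(Nat.primesBelow (N.sqrt + 1)) := by
      gcongr
      · refine le_trans ?_ (primorial_le_four_pow B)
        refine prod_le_prod_of_subset_of_one_le' (fun p hp => ?_) fun p hp _ => ?_
        · rw [mem_filter, mem_range]
          exact ⟨by have := (hS p hp).2; omega, (hS p hp).1⟩
        · exact (mem_filter.1 hp).2.pos
      · rw [← prod_filter, prod_const]
        refine Nat.pow_le_pow_right (Nat.pos_of_ne_zero hN) (card_le_card fun p hp => ?_)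
        rw [mem_filter] at hp
        exact Nat.mem_primesBelow.2 ⟨by omega, (hS p hp.1).1⟩

lemma nine_pow_mul_lt {k : ℕ} (hk : 20 ≤ k) : 9 ^ k * (16 * k ^ 2) < 16 ^ k := by
  induction k, hk using Nat.le_induction with
  | base => norm_num
  | succ k hk ih =>
    calc 9 ^ (k + 1) * (16 * (k + 1) ^ 2) = 9 ^ k * 16 * (9 * (k + 1) ^ 2) := by ring
      _ ≤ 9 ^ k * 16 * (16 * k ^ 2) := Nat.mul_le_mul_left _ (by nlinarith)
      _ = 16 * (9 ^ k * (16 * k ^ 2)) := by ring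
      _ < 16 * 16 ^ k := by omega
      _ = _ := by ring

lemma OddSmooth.nine_mul_lt {k m : ℕ} (h : OddSmooth k m) (hk : 1200 ≤ k) (hm : Odd m)
    (hkm : 2 * k + 1 < m) : 9 * (m + 2 * (k - 1)) < k ^ 2 := by
  have h1 := four_mul_pow_le (by omega) hm hkm
  set P := ∏ j ∈ range k, (m + 2 * j)
  set N := m + 2 * (k - 1)
  have hN : 0 < N := by omega
  have hcard : 2 * #P.primeFactors ≤ k := by
    refine le_trans ?_ (card_primesBelow_le_half hk)
    gcongr
    intro p hp
    obtain ⟨hpp, -, hpk, -⟩ := h.of_mem_primeFactors hm hp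
    exact Nat.mem_primesBelow.2 ⟨by omega, hpp⟩
  by_contra! hNk
  have h2 : (4 * N) ^ k ≤ 4 * k ^ (k + 1) * N ^ #P.primeFactors :=
    h1.trans (Nat.mul_le_mul_left _ (prod_primeFactors_pow_log_le P hN.ne'))
  have h3 : (16 * N) ^ k * N ^ k ≤ 16 * k ^ 2 * (k ^ 2) ^ k * N ^ k := by
    calc (16 * N) ^ k * N ^ k = ((4 * N) ^ k) ^ 2 := by
          rw [← mul_pow, ← pow_mul, mul_comm k 2, pow_mul]; congr 1; ring
      _ ≤ (4 * k ^ (k + 1) * N ^ #P.primeFactors) ^ 2 := by gcongr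
      _ = 16 * k ^ 2 * (k ^ 2) ^ k * N ^ (2 * #P.primeFactors) := by ring
      _ ≤ _ := by gcongr
  have h4 := Nat.le_of_mul_le_mul_right h3 (by positivity)
  have h5 : 16 ^ k * (k ^ 2) ^ k ≤ 9 ^ k * (16 * k ^ 2) * (k ^ 2) ^ k := by
    calc 16 ^ k * (k ^ 2) ^ k ≤ 16 ^ k * (9 * N) ^ k := by gcongr
      _ = 9 ^ k * (16 * N) ^ k := by rw [← mul_pow, ← mul_pow]; congr 1; ring
      _ ≤ 9 ^ k * (16 * k ^ 2 * (k ^ 2) ^ k) := by gcongr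
      _ = _ := by ring
  have h6 := Nat.le_of_mul_le_mul_right h5 (by positivity)
  exact absurd h6 (not_le.2 (nine_pow_mul_lt (by omega)))

/-- The logarithmic form of `four_mul_pow_le` when the prime factors are at most `B`. -/
lemma mul_log_le_of_primeFactors_le {k m B N : ℕ} (hN : N = m + 2 * (k - 1)) (hk : 1200 ≤ k)
    (hm : Odd m) (hkm : 2 * k + 1 < m)
    (hB : ∀ p ∈ (∏ j ∈ range k, (m + 2 * j)).primeFactors, p ≤ B) :
    k * Real.log (4 * N / k) ≤ Real.log (4 * k) + B * Real.log 4 +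
      (2 * √N / 3 + 6) * Real.log √N := by
  have h1 := four_mul_pow_le (by omega) hm hkm
  rw [← hN] at h1
  have hN0 : 36 ≤ N := by omega
  have h2 := h1.trans (Nat.mul_le_mul_left _ (prod_pow_log_le_four_pow (by omega)
    fun p hp => ⟨Nat.prime_of_mem_primeFactors hp, hB p hp⟩))
  have hc := card_primesBelow_sqrt_le hN0
  set c := #(Nat.primesBelow (N.sqrt + 1))
  have hk0 : (0 : ℝ) < k := by norm_cast; omega
  have hNr : (0 : ℝ) < N := by norm_cast; omega
  have hc' : (c : ℝ) ≤ √N / 3 + 3 := by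
    have : (3 * c : ℝ) ≤ N.sqrt + 9 := by exact_mod_cast hc
    have := Real.nat_sqrt_le_real_sqrt (a := N)
    linarith
  have hlog : Real.log N = 2 * Real.log √N := by
    rw [Real.log_sqrt hNr.le]; ring
  have hy : 0 ≤ Real.log √N := by
    have : 0 ≤ Real.log N := Real.log_natCast_nonneg N
    linarith
  have h3 : ((4 * N : ℝ)) ^ k ≤ 4 * (k : ℝ) ^ (k + 1) * (4 ^ B * (N : ℝ) ^ c) := by
    exact_mod_cast h2
  have h4 := Real.log_le_log (by positivity) h3
  rw [Real.log_pow, Real.log_mul (by positivity) (by positivity),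
    Real.log_mul (by positivity) (by positivity), Real.log_mul (by positivity) (by positivity),
    Real.log_mul (by positivity) (by positivity), Real.log_pow, Real.log_pow, Real.log_pow] at h4
  rw [Real.log_div (by positivity) (by positivity), Real.log_mul (by positivity) (by positivity),
    Real.log_mul (by positivity) (by positivity)]
  push_cast at h4
  have h5 : c * Real.log N ≤ (2 * √N / 3 + 6) * Real.log √N := by
    rw [hlog]; nlinarith
  linarith

lemma Real.log_le_div_add {y : ℝ} (hy : 0 < y) : Real.log y ≤ y / 64 + 3.159 := by
  have h1 := Real.log_le_sub_one_of_pos (x := y / 64) (by positivity)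
  rw [Real.log_div hy.ne' (by norm_num), show (64 : ℝ) = 2 ^ 6 by norm_num, Real.log_pow] at h1
  have := Real.log_two_lt_d9
  norm_num at h1 ⊢
  linarith

lemma Real.le_log_four_thirds : 0.285 ≤ Real.log (4 / 3) := by
  have h : Real.log (2 ^ 7) ≤ Real.log ((4 / 3) ^ 17) :=
    Real.log_le_log (by norm_num) (by norm_num)
  rw [Real.log_pow, Real.log_pow] at h
  have := Real.log_two_gt_d9
  norm_num at h ⊢
  linarith

lemma Real.log_twelve_le : Real.log 12 ≤ 2.5 := by
  have h : Real.log (12 ^ 5) ≤ Real.log (2 ^ 18) :=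
    Real.log_le_log (by norm_num) (by norm_num)
  rw [Real.log_pow, Real.log_pow] at h
  have := Real.log_two_lt_d9
  norm_num at h ⊢
  linarith

lemma Real.le_log_of_ge {y : ℝ} (hy : 64 ≤ y) : 4.158 ≤ Real.log y := by
  have h : Real.log (2 ^ 6) ≤ Real.log y := Real.log_le_log (by norm_num) (by linarith)
  rw [Real.log_pow] at h
  have := Real.log_two_gt_d9
  norm_num at h ⊢
  linarith

lemma lt_mul_log_div {y κ : ℝ} (hy : 80 ≤ y) (hκ : 3 * y ≤ κ) (hκ' : 16 * κ ≤ 3 * y ^ 2) :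
    (2 * y / 3 + 9) * Real.log y < κ * Real.log (y ^ 2 / (4 * κ)) := by
  have hy0 : 0 < y := by linarith
  have hκ0 : 0 < κ := by linarith
  have hmem : 4 * κ / y ^ 2 ∈ Set.Icc (12 / y) (3 / 4) := by
    constructor
    · rw [div_le_div_iff₀ hy0 (by positivity)]; nlinarith
    · rw [div_le_div_iff₀ (by positivity) (by norm_num)]; linarith
  have hc := Real.concaveOn_negMulLog.min_le_of_mem_Icc (x := 12 / y) (y := 3 / 4)
    (Set.mem_Ici.2 (by positivity)) (Set.mem_Ici.2 (by norm_num)) hmem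
  have hrew : κ * Real.log (y ^ 2 / (4 * κ)) = y ^ 2 / 4 * Real.negMulLog (4 * κ / y ^ 2) := by
    rw [Real.negMulLog, ← inv_div (4 * κ), Real.log_inv]
    field_simp
  rw [hrew]
  have hlog := Real.log_le_div_add hy0
  have hlog' := Real.le_log_of_ge (y := y) (by linarith)
  refine lt_of_lt_of_le ?_ (mul_le_mul_of_nonneg_left hc (by positivity))
  rcases min_choice (Real.negMulLog (12 / y)) (Real.negMulLog (3 / 4)) with h | h <;> rw [h]
  · have : y ^ 2 / 4 * Real.negMulLog (12 / y) = 3 * y * (Real.log y - Real.log 12) := by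
      rw [Real.negMulLog, Real.log_div (by norm_num) hy0.ne']
      field_simp
      ring
    rw [this]
    have := Real.log_twelve_le
    nlinarith
  · have : y ^ 2 / 4 * Real.negMulLog (3 / 4) = 3 / 16 * y ^ 2 * Real.log (4 / 3) := by
      rw [Real.negMulLog, ← inv_div (4 : ℝ) 3, Real.log_inv]
      ring
    rw [this]
    have := Real.le_log_four_thirds
    have h1 : (2 * y / 3 + 9) * Real.log y ≤ (2 * y / 3 + 9) * (y / 64 + 3.159) := by gcongr
    have h2 : 3 / 16 * y ^ 2 * 0.285 ≤ 3 / 16 * y ^ 2 * Real.log (4 / 3) := by gcongr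
    nlinarith

theorem not_oddSmooth {k m : ℕ} (hk : 4 ≤ k) (hm : Odd m) (hkm : 2 * k + 1 < m) :
    ¬ OddSmooth k m := by
  rcases lt_or_ge k 1200 with hk' | hk'
  · exact not_oddSmooth_of_lt hk hk' hm hkm
  intro h
  have h9 := h.nine_mul_lt hk' hm hkm
  obtain ⟨N, hN⟩ : ∃ N, N = m + 2 * (k - 1) := ⟨_, rfl⟩
  rw [← hN] at h9
  have hkN : 4 * k + 1 ≤ N := by
    obtain ⟨t, rfl⟩ := hm
    omega
  have hk0 : (1200 : ℝ) ≤ k := by exact_mod_cast hk'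
  have hkNr : (4 * k : ℝ) ≤ N := by norm_cast; omega
  set y := √(N : ℝ) with hy
  have hy2 : y ^ 2 = N := Real.sq_sqrt (Nat.cast_nonneg N)
  have hy64 : 69 ≤ y := Real.le_sqrt_of_sq_le (by linarith)
  have hlogN : Real.log N = 2 * Real.log y := by
    rw [hy, Real.log_sqrt (Nat.cast_nonneg N)]; ring
  have hlogk : Real.log (4 * k) ≤ 2 * Real.log y :=
    hlogN ▸ Real.log_le_log (by positivity) hkNr
  have hlog4 : Real.log 4 = 2 * Real.log 2 := by
    rw [show (4 : ℝ) = 2 ^ 2 by norm_num, Real.log_pow]; norm_num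
  have hlogy := Real.log_le_div_add (y := y) (by linarith)
  have hlogy' := Real.le_log_of_ge (y := y) (by linarith)
  have hl1 := Real.log_two_gt_d9
  have hl2 := Real.log_two_lt_d9
  rcases le_total (3 * N) (16 * k) with hs | hs
  · have hB : ∀ p ∈ (∏ j ∈ range k, (m + 2 * j)).primeFactors, p ≤ N / 3 := by
      intro p hp
      obtain ⟨hpp, hp2, hpk, j, hj, t, ht⟩ := h.of_mem_primeFactors hm hp
      rw [Nat.le_div_iff_mul_le (by norm_num)]
      have ht3 : 3 ≤ t := by
        by_contra! ht3
        obtain ⟨u, hu⟩ := hm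
        interval_cases t <;> omega
      have := Nat.mul_le_mul_left p ht3
      omega
    have h1 := mul_log_le_of_primeFactors_le hN hk' hm hkm hB
    rw [← hy] at h1
    have hB3 : ((N / 3 : ℕ) : ℝ) ≤ 16 * k / 9 := by
      have h2 : 9 * (N / 3) ≤ 16 * k := by omega
      have h3 : (9 * (N / 3 : ℕ) : ℝ) ≤ 16 * k := by exact_mod_cast h2
      linarith
    have h16 : 2 * Real.log 4 ≤ Real.log (4 * N / k) := by
      rw [← Real.log_rpow (by norm_num)]
      refine Real.log_le_log (by positivity) ?_
      rw [le_div_iff₀ (by linarith)]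
      norm_num
      linarith
    have h3N : (3 * N : ℝ) ≤ 16 * k := by exact_mod_cast hs
    have h4 : k * (2 * Real.log 4) ≤ k * Real.log (4 * N / k) := by gcongr
    have h5 : ((N / 3 : ℕ) : ℝ) * Real.log 4 ≤ 16 * k / 9 * Real.log 4 := by
      gcongr
    have h6 : 2 / 9 * k * Real.log 4 ≤ (2 * y / 3 + 8) * Real.log y := by linarith
    have h7 : (2 * y / 3 + 8) * Real.log y ≤ (2 * y / 3 + 8) * (y / 64 + 3.159) := by gcongr
    have h8 : 2 / 9 * (3 / 16 * y ^ 2) * 1.386 ≤ 2 / 9 * k * Real.log 4 := by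
      gcongr <;> linarith
    nlinarith
  · have hB : ∀ p ∈ (∏ j ∈ range k, (m + 2 * j)).primeFactors, p ≤ 2 * k + 1 := fun p hp =>
      (h.of_mem_primeFactors hm hp).2.2.1
    have h1 := mul_log_le_of_primeFactors_le hN hk' hm hkm hB
    rw [← hy] at h1
    have h3N : (16 * k : ℝ) ≤ 3 * N := by exact_mod_cast hs
    have h9r : (9 * N : ℝ) ≤ k ^ 2 := by exact_mod_cast h9.le
    have hyk : 3 * y ≤ k := abs_le_of_sq_le_sq' (by rw [mul_pow, hy2]; linarith) (by positivity) |>.2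
    have hy80 : 80 ≤ y := Real.le_sqrt_of_sq_le (by linarith)
    have h2 := lt_mul_log_div hy80 hyk (by rw [hy2]; linarith)
    have hkpos : (0 : ℝ) < k := by linarith
    have hNpos : (0 : ℝ) < N := by linarith
    have h3 : Real.log (4 * N / k) = Real.log (y ^ 2 / (4 * k)) + 2 * Real.log 4 := by
      rw [hy2, Real.log_div (by positivity) (by positivity),
        Real.log_div (by positivity) (by positivity), Real.log_mul (by norm_num) (by positivity),
        Real.log_mul (by norm_num) (by positivity)]
      ring
    rw [h3] at h1
    push_cast at h1
    linarith

lemma degree_sum_descPochhammer_lt (d : ℕ) (c : ℕ → ℚ) :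
    (∑ n ∈ range d, C (c n) * descPochhammer ℚ n).degree < d := by
  refine (degree_sum_le _ _).trans_lt ((Finset.sup_lt_iff (WithBot.bot_lt_coe d)).2 fun n hn => ?_)
  rw [← smul_eq_C_mul]
  refine (degree_smul_le _ _).trans_lt ?_
  rw [degree_eq_natDegree (monic_descPochhammer ℚ n).ne_zero, descPochhammer_natDegree]
  exact Nat.cast_lt.2 (mem_range.1 hn)

lemma coeff_sum_descPochhammer (d : ℕ) (c : ℕ → ℚ) :
    (∑ n ∈ range (d + 1), C (c n) * descPochhammer ℚ n).coeff d = c d := by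
  have h := (monic_descPochhammer ℚ d).coeff_natDegree
  rw [descPochhammer_natDegree] at h
  rw [sum_range_succ, coeff_add, coeff_C_mul, h,
    coeff_eq_zero_of_degree_lt (degree_sum_descPochhammer_lt d c)]
  ring

lemma exists_int_of_sum_descPochhammer_mem_lifts (d : ℕ) (c : ℕ → ℚ)
    (h : ∑ n ∈ range d, C (c n) * descPochhammer ℚ n ∈ lifts (Int.castRingHom ℚ)) :
    ∀ n < d, ∃ z : ℤ, c n = z := by
  induction d with
  | zero => simp
  | succ d ih =>
    obtain ⟨q, hq⟩ := (mem_lifts _).1 h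
    have hd : c d = (q.coeff d : ℤ) := by
      rw [← coeff_sum_descPochhammer d c, ← hq, coeff_map]
      rfl
    intro n hn
    rcases Nat.lt_succ_iff_lt_or_eq.1 hn with hn | rfl
    · refine ih ((mem_lifts _).2 ⟨q - C (q.coeff d) * descPochhammer ℤ d, ?_⟩) n hn
      rw [Polynomial.map_sub, Polynomial.map_mul, descPochhammer_map, map_C, hq, sum_range_succ,
        hd]
      simp
    · exact ⟨_, hd⟩

lemma mem_lifts_of_roots_int {f : ℚ[X]} {u : ℤ} (hu : f.leadingCoeff = u)
    (h : ∀ z : ℂ, aeval z f = 0 → ∃ k : ℤ, z = k) : f ∈ lifts (Int.castRingHom ℚ) := by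
  rcases eq_or_ne f 0 with rfl | hf
  · exact zero_mem _
  have hinj : Function.Injective (algebraMap ℚ ℂ) := (algebraMap ℚ ℂ).injective
  have hc : f.map (algebraMap ℚ ℂ) ∈ lifts (Int.castRingHom ℂ) := by
    rw [(IsAlgClosed.splits (f.map (algebraMap ℚ ℂ))).eq_prod_roots, leadingCoeff_map, hu]
    refine mul_mem ?_ (Subsemiring.multiset_prod_mem _ _ ?_)
    · simpa using C_mem_lifts (Int.castRingHom ℂ) u
    · intro g hg
      obtain ⟨a, ha, rfl⟩ := Multiset.mem_map.1 hg
      rw [mem_roots (by simpa using hf), IsRoot, eval_map_algebraMap] at ha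
      obtain ⟨k, rfl⟩ := h a ha
      exact (mem_lifts _).2 ⟨X - C k, by simp⟩
  obtain ⟨q, hq⟩ := (mem_lifts _).1 hc
  refine (mem_lifts _).2 ⟨q, map_injective _ hinj ?_⟩
  rw [Polynomial.map_map, ← hq]
  congr 1

lemma exists_int_pcoef {r s : ℕ}
    (hzeros : ∀ z : ℂ, aeval z (Phi r s) = 0 → ∃ k : ℤ, z = (k : ℂ)) :
    ∀ i ≤ s, ∃ z : ℤ, pcoef r s i = z := by
  set c : ℕ → ℚ := fun n => (-1) ^ n * pcoef r s (s - n) with hc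
  have hPhi : Phi r s = ∑ n ∈ range (s + 1), C (c n) * descPochhammer ℚ n := by
    rw [Phi, ← sum_flip]
    refine sum_congr rfl fun n hn => ?_
    rw [hc, Nat.sub_sub_self (Nat.lt_succ_iff.1 (mem_range.1 hn))]
  have hcs : c s = (-1) ^ s := by simp [hc, pcoef]
  have hcoeff : (Phi r s).coeff s = (-1) ^ s := by
    rw [hPhi, coeff_sum_descPochhammer, hcs]
  have hdeg : (Phi r s).natDegree = s := by
    refine le_antisymm ?_ (le_natDegree_of_ne_zero (by rw [hcoeff]; simp))
    have := degree_sum_descPochhammer_lt (s + 1) c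
    rw [← hPhi] at this
    have h0 : Phi r s ≠ 0 := fun h0 => by
      rw [h0, coeff_zero] at hcoeff
      exact pow_ne_zero s (by norm_num) hcoeff.symm
    exact Nat.lt_succ_iff.1 ((natDegree_lt_iff_degree_lt h0).2 this)
  have hlift := mem_lifts_of_roots_int (u := (-1) ^ s) (f := Phi r s)
    (by rw [leadingCoeff, hdeg, hcoeff]; simp) hzeros
  rw [hPhi] at hlift
  intro i hi
  obtain ⟨z, hz⟩ := exists_int_of_sum_descPochhammer_mem_lifts _ c hlift (s - i) (by omega)
  rw [hc] at hz
  simp only [Nat.sub_sub_self hi] at hz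
  rcases neg_one_pow_eq_or ℚ (s - i) with h | h <;> rw [h] at hz
  · exact ⟨z, by linarith⟩
  · exact ⟨-z, by push_cast; linarith⟩

lemma ascPochhammer_eval_eq_prod (n : ℕ) (x : ℚ) :
    (ascPochhammer ℚ n).eval x = ∏ j ∈ range n, (x + j) := by
  induction n with
  | zero => simp
  | succ n ih => rw [ascPochhammer_succ_eval, ih, prod_range_succ]

lemma pcoef_mul_eq (r s i : ℕ) :
    pcoef r s i * (2 ^ i * ∏ j ∈ range (i / 2), (2 * (r : ℚ) + 1 + 2 * j)) =
      2 ^ (i / 2) * s.choose i *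
        ((∏ l ∈ range (i / 2), ((r : ℚ) + i - 1 - l)) * ∏ l ∈ range i, ((r : ℚ) + 1 + l)) := by
  have h : ∏ j ∈ range (i / 2), (2 * (r : ℚ) + 1 + 2 * j) =
      2 ^ (i / 2) * ∏ j ∈ range (i / 2), ((r : ℚ) + 1 / 2 + j) := by
    rw [← card_range (i / 2), ← prod_const, card_range, ← prod_mul_distrib]
    exact prod_congr rfl fun j _ => by ring
  have h0 : ∏ j ∈ range (i / 2), ((r : ℚ) + 1 / 2 + j) ≠ 0 :=
    (prod_pos fun j _ => by positivity).ne'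
  rw [h, pcoef, descPochhammer_eval_eq_prod_range, ascPochhammer_eval_eq_prod,
    ascPochhammer_eval_eq_prod]
  field_simp

lemma int_mul_eq_of_pcoef_eq {r s i : ℕ} {z : ℤ} (hz : pcoef r s i = z) :
    z * (2 ^ i * ∏ j ∈ range (i / 2), (2 * (r : ℤ) + 1 + 2 * j)) =
      2 ^ (i / 2) * s.choose i *
        ((∏ l ∈ range (i / 2), ((r : ℤ) + i - 1 - l)) * ∏ l ∈ range i, ((r : ℤ) + 1 + l)) := by
  have := pcoef_mul_eq r s i
  rw [hz] at this
  exact_mod_cast this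

lemma not_exists_int_pcoef {r s i p j : ℕ} (hp : p.Prime) (hp2 : p ≠ 2)
    (hs : ¬ p ∣ s.choose i) (hj : j < i / 2) (hpj : p ∣ 2 * r + 1 + 2 * j)
    (hr : ∀ l < i, ¬ p ∣ r + 1 + l) : ¬ ∃ z : ℤ, pcoef r s i = z := by
  rintro ⟨z, hz⟩
  have h := int_mul_eq_of_pcoef_eq hz
  have hpi : Prime (p : ℤ) := Nat.prime_iff_prime_int.1 hp
  have h1 : (p : ℤ) ∣ z * (2 ^ i * ∏ j ∈ range (i / 2), (2 * (r : ℤ) + 1 + 2 * j)) := by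
    refine Dvd.dvd.mul_left (Dvd.dvd.mul_left (Dvd.dvd.trans ?_
      (dvd_prod_of_mem _ (mem_range.2 hj))) _) _
    exact_mod_cast hpj
  rw [h] at h1
  rcases hpi.dvd_or_dvd h1 with h2 | h2
  · rcases hpi.dvd_or_dvd h2 with h3 | h3
    · have h4 : p ∣ 2 := by exact_mod_cast hpi.dvd_of_dvd_pow h3
      exact hp2 ((Nat.prime_dvd_prime_iff_eq hp Nat.prime_two).1 h4)
    · exact hs (by exact_mod_cast h3)
  · rcases hpi.dvd_or_dvd h2 with h3 | h3
    · obtain ⟨l, hl, h4⟩ := (hpi.dvd_finsetProd_iff _).1 h3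
      rw [mem_range] at hl
      refine hr (i - 2 - l) (by omega) ?_
      rw [← Int.natCast_dvd_natCast,
        show ((r + 1 + (i - 2 - l) : ℕ) : ℤ) = r + i - 1 - l by omega]
      exact h4
    · obtain ⟨l, hl, h4⟩ := (hpi.dvd_finsetProd_iff _).1 h3
      exact hr l (mem_range.1 hl) (by exact_mod_cast h4)

lemma Nat.Prime.not_dvd_choose_of_le_mod {p n k : ℕ} (hp : p.Prime) (h : k ≤ n % p) :
    ¬ p ∣ n.choose k := by
  have := Fact.mk hp
  have hn : n % p < p := Nat.mod_lt _ hp.pos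
  intro hd
  have h1 := (Choose.choose_modEq_choose_mod_mul_choose_div_nat (n := n) (k := k)
    (p := p)).dvd_iff dvd_rfl |>.1 hd
  rw [Nat.mod_eq_of_lt (h.trans_lt hn), Nat.div_eq_of_lt (h.trans_lt hn), Nat.choose_zero_right,
    mul_one] at h1
  have h2 : p ∣ (n % p).factorial := by
    rw [← Nat.choose_mul_factorial_mul_factorial h, mul_assoc]
    exact h1.mul_right _
  exact absurd ((hp.dvd_factorial).1 h2) (not_le.2 hn)

lemma not_dvd_add_of_integral {r s : ℕ} (H : ∀ i ≤ s, ∃ z : ℤ, pcoef r s i = z)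
    (hr : 2 ≤ r) {p j : ℕ} (hp : p.Prime) (hpr : 2 * r + 1 ≤ p)
    (hj : 1 ≤ j) (hj' : j ≤ 2 * r - 1) : ¬ p ∣ s + j := by
  intro hd
  have hodd := hp.odd_of_ne_two (by omega)
  have hmod : s % p = p - j := by
    obtain ⟨t, ht⟩ := hd
    rcases t with _ | t
    · omega
    · rw [mul_add, mul_one] at ht
      rw [show s = (p - j) + p * t by omega, Nat.add_mul_mod_self_left,
        Nat.mod_eq_of_lt (by omega)]
  have hs : p - j ≤ s := hmod ▸ Nat.mod_le s p
  obtain ⟨q, rfl⟩ := hodd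
  refine not_exists_int_pcoef (i := 2 * q + 1 - 2 * r + 1) (j := q - r) hp (by omega)
    (hp.not_dvd_choose_of_le_mod (by omega)) (by omega) ⟨1, by omega⟩ (fun l hl hdl => ?_)
    (H _ (by omega))
  have := Nat.le_of_dvd (by omega) hdl
  omega

lemma le_succ_of_integral {r s : ℕ} (H : ∀ i ≤ s, ∃ z : ℤ, pcoef r s i = z)
    {p j : ℕ} (hp : p.Prime) (hj : j < s / 2)
    (hpj : p ∣ 2 * r + 1 + 2 * j) : p ≤ s + 1 := by
  by_contra! hps
  refine not_exists_int_pcoef (i := 2 * j + 2) (j := j) hp (by omega)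
    (hp.not_dvd_choose_of_le_mod (by rw [Nat.mod_eq_of_lt (by omega)]; omega)) (by omega) hpj
    (fun l hl hdl => ?_) (H _ (by omega))
  have h1 : (p : ℤ) ∣ 2 * ((r + 1 + l : ℕ) : ℤ) - ((2 * r + 1 + 2 * j : ℕ) : ℤ) :=
    dvd_sub ((Int.natCast_dvd_natCast.2 hdl).mul_left _) (Int.natCast_dvd_natCast.2 hpj)
  have h2 := Int.eq_zero_of_abs_lt_dvd h1 (by rw [abs_lt]; omega)
  omega

lemma dvd_three_mul_of_integral {r s : ℕ} (H : ∀ i ≤ s, ∃ z : ℤ, pcoef r s i = z)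
    (hs : 2 ≤ s) : 2 * r + 1 ∣ 3 * (s * (s - 1)) := by
  obtain ⟨z, hz⟩ := H 2 hs
  have h := int_mul_eq_of_pcoef_eq hz
  have hc : 2 * (s.choose 2 : ℤ) = ((s * (s - 1) : ℕ) : ℤ) := by
    rw [Nat.choose_two_right]
    exact_mod_cast Nat.mul_div_cancel' (Nat.even_mul_pred_self s).two_dvd
  rw [← Int.natCast_dvd_natCast, Nat.cast_mul, ← hc]
  push_cast
  norm_num [prod_range_succ] at h
  refine ⟨32 * z - 2 * s.choose 2 * (2 * r + 1) * (2 * r + 1) - 10 * s.choose 2 * (2 * r + 1) -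
    14 * s.choose 2, ?_⟩
  linear_combination (-8) * h

lemma two_dvd_of_integral {r s : ℕ} (H : ∀ i ≤ s, ∃ z : ℤ, pcoef r s i = z)
    (hs : 1 ≤ s) : 2 ∣ s * (r + 1) := by
  obtain ⟨z, hz⟩ := H 1 hs
  have h := int_mul_eq_of_pcoef_eq hz
  simp at h
  zify
  exact ⟨z, by linarith⟩

lemma exists_prime_dvd_of_odd {k m : ℕ} (hk : 4 ≤ k) (hm : Odd m) (hkm : 2 * k + 1 < m) :
    ∃ j < k, ∃ p, p.Prime ∧ p ∣ m + 2 * j ∧ 2 * k + 1 < p := by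
  have h := not_oddSmooth hk hm hkm
  unfold OddSmooth at h
  push Not at h
  exact h

lemma ascFactorial_le_of_smooth {n s : ℕ}
    (h : ∀ p, p.Prime → ∀ j, 1 ≤ j → j ≤ n → p ∣ s + j → p ≤ n) :
    (s + 1).ascFactorial n ≤ n.factorial * (s + n) ^ #(Nat.primesBelow (n + 1)) := by
  rw [Nat.ascFactorial_eq_factorial_mul_choose]
  gcongr
  rcases Nat.eq_zero_or_pos n with rfl | hn
  · simp
  have h0 : (s + n).choose n ≠ 0 := (Nat.choose_pos (by omega)).ne'
  rw [← Nat.prod_factorization_pow_eq_self h0, Finsupp.prod, Nat.support_factorization]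
  refine (prod_le_pow_card _ _ _ fun p _ => Nat.pow_factorization_choose_le (by omega)).trans ?_
  refine Nat.pow_le_pow_right (by omega) (card_le_card fun p hp => ?_)
  have hpp := Nat.prime_of_mem_primeFactors hp
  have hd : p ∣ (s + 1).ascFactorial n := by
    rw [Nat.ascFactorial_eq_factorial_mul_choose]
    exact (Nat.dvd_of_mem_primeFactors hp).mul_left _
  rw [Nat.ascFactorial_eq_prod_range, hpp.prime.dvd_finsetProd_iff] at hd
  obtain ⟨j, hj, hd⟩ := hd
  rw [mem_range] at hj
  rw [show s + 1 + j = s + (j + 1) by ring] at hd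
  have := h p hpp (j + 1) (by omega) (by omega) hd
  exact Nat.mem_primesBelow.2 ⟨by omega, hpp⟩

lemma not_smooth_three {s : ℕ} (hs : 3 ≤ s)
    (h : ∀ p, p.Prime → ∀ j, 1 ≤ j → j ≤ 3 → p ∣ s + j → p ≤ 3) : False := by
  have h1 := ascFactorial_le_of_smooth h
  rw [show #(Nat.primesBelow (3 + 1)) = 2 by decide +kernel] at h1
  rcases le_or_gt s 5 with h2 | h2
  · rcases le_or_gt s 4 with h3 | h3
    · have := h 5 (by norm_num) (5 - s) (by omega) (by omega) ⟨1, by omega⟩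
      omega
    · have := h 7 (by norm_num) (7 - s) (by omega) (by omega) ⟨1, by omega⟩
      omega
  · obtain ⟨t, rfl⟩ := Nat.exists_eq_add_of_le h2
    simp only [Nat.ascFactorial, Nat.factorial] at h1
    ring_nf at h1
    linarith [Nat.zero_le t, Nat.zero_le (t ^ 2), Nat.zero_le (t ^ 3), Nat.zero_le (t ^ 4),
      Nat.zero_le (t ^ 5), Nat.zero_le (t ^ 6), Nat.zero_le (t ^ 7)]

lemma not_smooth_five {s : ℕ} (hs : 5 ≤ s)
    (h : ∀ p, p.Prime → ∀ j, 1 ≤ j → j ≤ 5 → p ∣ s + j → p ≤ 5) : False := by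
  have h1 := ascFactorial_le_of_smooth h
  rw [show #(Nat.primesBelow (5 + 1)) = 3 by decide +kernel] at h1
  rcases le_or_gt s 11 with h2 | h2
  · rcases le_or_gt s 6 with h3 | h3
    · have := h 7 (by norm_num) (7 - s) (by omega) (by omega) ⟨1, by omega⟩
      omega
    rcases le_or_gt s 10 with h4 | h4
    · have := h 11 (by norm_num) (11 - s) (by omega) (by omega) ⟨1, by omega⟩
      omega
    · have := h 13 (by norm_num) (13 - s) (by omega) (by omega) ⟨1, by omega⟩
      omega
  · obtain ⟨t, rfl⟩ := Nat.exists_eq_add_of_le h2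
    simp only [Nat.ascFactorial, Nat.factorial] at h1
    ring_nf at h1
    linarith [Nat.zero_le t, Nat.zero_le (t ^ 2), Nat.zero_le (t ^ 3), Nat.zero_le (t ^ 4),
      Nat.zero_le (t ^ 5), Nat.zero_le (t ^ 6), Nat.zero_le (t ^ 7)]

lemma not_smooth_seven {s : ℕ} (hs : 7 ≤ s)
    (h : ∀ p, p.Prime → ∀ j, 1 ≤ j → j ≤ 7 → p ∣ s + j → p ≤ 7) : False := by
  have h1 := ascFactorial_le_of_smooth h
  rw [show #(Nat.primesBelow (7 + 1)) = 4 by decide +kernel] at h1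
  rcases le_or_gt s 16 with h2 | h2
  · rcases le_or_gt s 10 with h3 | h3
    · have := h 11 (by norm_num) (11 - s) (by omega) (by omega) ⟨1, by omega⟩
      omega
    · have := h 17 (by norm_num) (17 - s) (by omega) (by omega) ⟨1, by omega⟩
      omega
  · obtain ⟨t, rfl⟩ := Nat.exists_eq_add_of_le h2
    simp only [Nat.ascFactorial, Nat.factorial] at h1
    ring_nf at h1
    linarith [Nat.zero_le t, Nat.zero_le (t ^ 2), Nat.zero_le (t ^ 3), Nat.zero_le (t ^ 4),
      Nat.zero_le (t ^ 5), Nat.zero_le (t ^ 6), Nat.zero_le (t ^ 7)]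

/-- Among `2 r - 1` consecutive integers above `2 r - 1`, one has a prime factor above `2 r`. -/
lemma exists_prime_dvd_add {r s : ℕ} (hr : 2 ≤ r) (hs : 2 * r - 1 ≤ s) :
    ∃ p, p.Prime ∧ 2 * r + 1 ≤ p ∧ ∃ j, 1 ≤ j ∧ j ≤ 2 * r - 1 ∧ p ∣ s + j := by
  by_contra! h
  have h' : ∀ p, p.Prime → ∀ j, 1 ≤ j → j ≤ 2 * r - 1 → p ∣ s + j → p ≤ 2 * r - 1 := by
    intro p hp j hj hj' hd
    by_contra! hpr
    rcases hp.eq_two_or_odd' with h2 | ⟨q, hq⟩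
    · omega
    · exact h p hp (by omega) j hj hj' hd
  rcases lt_or_ge r 5 with h5 | h5
  · interval_cases r
    · exact not_smooth_three hs h'
    · exact not_smooth_five hs h'
    · exact not_smooth_seven hs h'
  · rcases Nat.even_or_odd s with he | ho
    · obtain ⟨j, hj, p, hp, hd, hlt⟩ := exists_prime_dvd_of_odd (k := r - 1) (m := s + 1)
        (by omega) he.add_one (by obtain ⟨t, rfl⟩ := he; omega)
      have := h' p hp (1 + 2 * j) (by omega) (by omega) (by rwa [← add_assoc])
      omega
    · obtain ⟨j, hj, p, hp, hd, hlt⟩ := exists_prime_dvd_of_odd (k := r - 1) (m := s + 2)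
        (by omega) (ho.add_even even_two) (by omega)
      have := h' p hp (2 + 2 * j) (by omega) (by omega) (by rwa [← add_assoc])
      omega

lemma false_of_integral_of_lt {r s : ℕ} (H : ∀ i ≤ s, ∃ z : ℤ, pcoef r s i = z)
    (hs : 2 ≤ s) (hsr : s < 2 * r - 1) : False := by
  have hle : ∀ p, p.Prime → ∀ j < s / 2, p ∣ 2 * r + 1 + 2 * j → p ≤ s + 1 :=
    fun p hp j hj hd => le_succ_of_integral H hp hj hd
  rcases lt_or_ge s 8 with h8 | h8
  · have h3 := dvd_three_mul_of_integral H hs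
    have h2 := two_dvd_of_integral H (by omega)
    have hr := Nat.le_of_dvd (by have : 0 < s - 1 := by omega
                                 positivity) h3
    have h11 := hle 11 (by norm_num) 1
    have h13 := hle 13 (by norm_num) 1
    have h17 := hle 17 (by norm_num) 1
    have h23 := hle 23 (by norm_num) 1
    have h47 := hle 47 (by norm_num) 1
    clear H hle
    interval_cases s <;> have hr' : r ≤ 62 := by omega
    all_goals interval_cases r <;> omega
  · obtain ⟨j, hj, p, hp, hd, hlt⟩ := exists_prime_dvd_of_odd (k := s / 2) (m := 2 * r + 1)
      (by omega) (odd_two_mul_add_one r) (by omega)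
    have := hle p hp j hj hd
    rcases hp.eq_two_or_odd' with h2 | ⟨q, hq⟩ <;> omega

/-- If every complex zero of `Φ_s` is an integer, then `s = 1`, or `r = 1`,
or `s ≥ 5000 r (14.5 + ln r)²`. -/
theorem stmt_3 (r s : ℕ) (hr : 0 < r) (hs : 0 < s)
    (hzeros : ∀ z : ℂ, Polynomial.aeval z (Phi r s) = 0 → ∃ k : ℤ, z = (k : ℂ)) :
    s = 1 ∨ r = 1 ∨ 5000 * (r : ℝ) * (14.5 + Real.log r) ^ 2 ≤ (s : ℝ) := by
  by_contra! h
  obtain ⟨hs1, hr1, -⟩ := h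
  have H := exists_int_pcoef hzeros
  rcases lt_or_ge s (2 * r - 1) with hsr | hsr
  · exact false_of_integral_of_lt H (by omega) hsr
  · obtain ⟨p, hp, hpr, j, hj, hj', hd⟩ := exists_prime_dvd_add (by omega) hsr
    exact not_dvd_add_of_integral H (by omega) hp hpr hj hj' hd
end
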